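/- arXiv:0708.2295 — 2 statements merged into one kernel-verified Lean document; each statement's English description precedes it below -/
import Mathlib

section
/- (Green–Ruzsa, case (a)) Let G be a finite abelian group of order n > 1. If n is divisible by some prime congruent to 2 modulo 3, and p is the least such prime, then α(G) = n/3 + n/(3p) (an equality of rational numbers). -/
/-- A subset `S` of a group is product-free if there are no `a, b, c ∈ S`
(not necessarily distinct) with `a * b = c`. -/
def IsProductFree {G : Type*} [Group G] (S : Finset G) : Prop :=
  ∀ a ∈ S, ∀ b ∈ S, ∀ c ∈ S, a * b ≠ c

/-- `α(G)`: the largest cardinality of a product-free subset of `G`. -/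
noncomputable def alphaPF (G : Type*) [Group G] [Fintype G] : ℕ :=
  sSup {k | ∃ S : Finset G, IsProductFree S ∧ S.card = k}

open Finset MulAction
open scoped Pointwise

section Kneser

variable {G : Type*} [CommGroup G] [Fintype G]

open Classical in
theorem Subgroup.card_filter_mem_eq (H : Subgroup G) :
    #{g : G | g ∈ H} = Nat.card H := by
  rw [Nat.card_eq_fintype_card, Fintype.card_subtype]

/-- Multiplication `H₂ × H₁ → G` is at most `|H₁ ∩ H₂|`-to-one. -/
theorem card_mul_card_le_card_inf_mul {H₁ H₂ : Subgroup G} {U Q D : Finset G} {x : G}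
    (hU : ∀ u ∈ U, u ∈ H₂) (hQ : ∀ q ∈ Q, q ∈ H₁) (hD : ∀ u ∈ U, ∀ q ∈ Q, x * (u * q) ∈ D) :
    #U * #Q ≤ Nat.card (H₁ ⊓ H₂ : Subgroup G) * #D := by
  classical
  rw [← card_product]
  refine card_le_mul_card_image_of_maps_to (f := fun z : G × G => x * (z.1 * z.2)) ?_ _ ?_
  · rintro ⟨u, q⟩ h
    rw [mem_product] at h
    exact hD u h.1 q h.2
  intro b _
  obtain h | ⟨⟨u₀, q₀⟩, h₀⟩ :=
    (filter (fun z : G × G => x * (z.1 * z.2) = b) (U ×ˢ Q)).eq_empty_or_nonempty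
  · simp [h]
  rw [← Subgroup.card_filter_mem_eq]
  simp only [mem_filter, mem_product] at h₀
  have key : ∀ u q : G, x * (u * q) = b → u * u₀⁻¹ = q₀ * q⁻¹ := by
    intro u q h
    have h' : u * q = u₀ * q₀ := mul_left_cancel (h.trans h₀.2.symm)
    rw [mul_inv_eq_iff_eq_mul, mul_right_comm, eq_mul_inv_iff_mul_eq, h', mul_comm]
  refine card_le_card_of_injOn (fun z => z.1 * u₀⁻¹) ?_ ?_
  · rintro ⟨u, q⟩ h
    simp only [coe_filter, mem_product, Set.mem_ofPred_eq] at h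
    simp only [coe_filter, mem_univ, true_and, Set.mem_ofPred_eq, Subgroup.mem_inf]
    refine ⟨?_, H₂.mul_mem (hU u h.1.1) (H₂.inv_mem (hU u₀ h₀.1.1))⟩
    rw [key u q h.2]
    exact H₁.mul_mem (hQ q₀ h₀.1.2) (H₁.inv_mem (hQ q h.1.2))
  · rintro ⟨u, q⟩ h ⟨u', q'⟩ h' huu
    simp only [coe_filter, mem_product, Set.mem_ofPred_eq] at h h'
    obtain rfl : u = u' := mul_right_cancel huu
    have : q = q' := mul_left_cancel (mul_left_cancel (h.2.trans h'.2.symm))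
    rw [this]

/-- The local estimate behind Kneser's union lemma, in the coset of `H₁ H₂` through `x`. -/
theorem card_sdiff_of_mem_sdiff [DecidableEq G] {C₁ C₂ : Finset G} {H₁ H₂ : Subgroup G}
    (h₁ : H₁ ≤ stabilizer G C₁) (h₂ : H₂ ≤ stabilizer G C₂) {x : G} (hx : x ∈ C₂ \ C₁) :
    Nat.card H₁ ≤ #(C₂ \ C₁) + Nat.card (H₁ ⊓ H₂ : Subgroup G) ∨
      Nat.card H₂ ≤ #(C₁ \ C₂) + Nat.card (H₁ ⊓ H₂ : Subgroup G) ∨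
      Nat.card H₂ ≤ #(C₂ \ C₁) := by
  classical
  rw [mem_sdiff] at hx
  have m₁ : ∀ h ∈ H₁, ∀ c, c * h ∈ C₁ ↔ c ∈ C₁ := fun h hh c => by
    simpa [mul_comm] using mem_stabilizer_finset.1 (h₁ hh) c
  have m₂ : ∀ h ∈ H₂, ∀ c, c * h ∈ C₂ ↔ c ∈ C₂ := fun h hh c => by
    simpa [mul_comm] using mem_stabilizer_finset.1 (h₂ hh) c
  set K := H₁ ⊓ H₂
  set U : Finset G := {g | g ∈ H₂ ∧ x * g ∉ C₁}
  set P : Finset G := {g | g ∈ H₂ ∧ x * g ∈ C₁}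
  set Q : Finset G := {g | g ∈ H₁ ∧ x * g ∈ C₂}
  set V : Finset G := {g | g ∈ H₁ ∧ x * g ∉ C₂}
  have hUP : #P + #U = Nat.card H₂ := by
    rw [← Subgroup.card_filter_mem_eq,
      ← card_filter_add_card_filter_not (s := {g : G | g ∈ H₂}) (fun g => x * g ∈ C₁),
      filter_filter, filter_filter]
  have hQV : #Q + #V = Nat.card H₁ := by
    rw [← Subgroup.card_filter_mem_eq,
      ← card_filter_add_card_filter_not (s := {g : G | g ∈ H₁}) (fun g => x * g ∈ C₂),
      filter_filter, filter_filter]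
  have hUQ : #U * #Q ≤ Nat.card K * #(C₂ \ C₁) := by
    refine card_mul_card_le_card_inf_mul (x := x) (by simp +contextual [U])
      (by simp +contextual [Q]) fun u hu q hq => ?_
    simp only [U, Q, mem_filter, mem_univ, true_and] at hu hq
    rw [mem_sdiff, ← mul_assoc, m₁ q hq.1, mul_right_comm, m₂ u hu.1]
    exact ⟨hq.2, hu.2⟩
  have hPV : #P * #V ≤ Nat.card K * #(C₁ \ C₂) := by
    refine card_mul_card_le_card_inf_mul (x := x) (by simp +contextual [P])
      (by simp +contextual [V]) fun u hu q hq => ?_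
    simp only [P, V, mem_filter, mem_univ, true_and] at hu hq
    rw [mem_sdiff, ← mul_assoc, m₁ q hq.1, mul_right_comm, m₂ u hu.1]
    exact ⟨hu.2, hq.2⟩
  have card_le : ∀ W : Finset G, ∀ w ∈ W, (∀ k ∈ K, w * k ∈ W) → Nat.card K ≤ #W := by
    intro W w _ hW
    rw [← Subgroup.card_filter_mem_eq]
    refine card_le_card_of_injOn (fun k => w * k) (fun k hk => ?_)
      (fun a _ b _ h => mul_left_cancel h)
    exact hW k (by simpa using hk)
  have hU : Nat.card K ≤ #U := by
    refine card_le U 1 (by simp [U, hx.2, H₂.one_mem]) fun k hk => ?_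
    simpa [U, m₁ k hk.1, hx.2] using hk.2
  have hQ : Nat.card K ≤ #Q := by
    refine card_le Q 1 (by simp [Q, hx.1, H₁.one_mem]) fun k hk => ?_
    simpa [Q, m₂ k hk.2, hx.1] using hk.1
  have hKpos : 0 < Nat.card K := Nat.card_pos
  obtain hP0 | ⟨g, hg⟩ := P.eq_empty_or_nonempty
  · right; right
    rw [hP0, card_empty, zero_add] at hUP
    rw [← hUP]
    exact le_of_mul_le_mul_left (by nlinarith) hKpos
  obtain hV0 | ⟨g', hg'⟩ := V.eq_empty_or_nonempty
  · left
    rw [hV0, card_empty, add_zero] at hQV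
    rw [← hQV]
    exact le_add_right (le_of_mul_le_mul_left (by nlinarith) hKpos)
  have hP : Nat.card K ≤ #P := by
    refine card_le P g hg fun k hk => ?_
    simp only [P, mem_filter, mem_univ, true_and] at hg ⊢
    rw [← mul_assoc, m₁ k hk.1]
    exact ⟨H₂.mul_mem hg.1 hk.2, hg.2⟩
  have hV : Nat.card K ≤ #V := by
    refine card_le V g' hg' fun k hk => ?_
    simp only [V, mem_filter, mem_univ, true_and] at hg' ⊢
    rw [← mul_assoc, m₂ k hk.2]
    exact ⟨H₁.mul_mem hg'.1 hk.1, hg'.2⟩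
  by_contra! hcon
  obtain ⟨c₁, c₂, -⟩ := hcon
  have e₁ := mul_le_mul_of_nonneg_left (show #(C₂ \ C₁) + Nat.card K + 1 ≤ Nat.card H₁ from c₁)
    hKpos.le
  have e₂ := mul_le_mul_of_nonneg_left (show #(C₁ \ C₂) + Nat.card K + 1 ≤ Nat.card H₂ from c₂)
    hKpos.le
  obtain ⟨u, hu⟩ := Nat.exists_eq_add_of_le hU
  obtain ⟨q, hq⟩ := Nat.exists_eq_add_of_le hQ
  obtain ⟨r, hr⟩ := Nat.exists_eq_add_of_le hP
  obtain ⟨v, hv⟩ := Nat.exists_eq_add_of_le hV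
  rw [← hQV, hq, hv] at e₁
  rw [← hUP, hu, hr] at e₂
  rw [hu, hq] at hUQ
  rw [hr, hv] at hPV
  nlinarith [Nat.zero_le (u * q), Nat.zero_le (r * v)]

/-- **Kneser's union lemma**. -/
theorem exists_le_card_union_add_card [DecidableEq G] {m : ℕ} {C₁ C₂ : Finset G}
    (h₁ : ∃ H ≤ stabilizer G C₁, m ≤ #C₁ + Nat.card H)
    (h₂ : ∃ H ≤ stabilizer G C₂, m ≤ #C₂ + Nat.card H) :
    ∃ H ≤ stabilizer G (C₁ ∪ C₂), m ≤ #(C₁ ∪ C₂) + Nat.card H := by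
  obtain ⟨H₁, hs₁, hm₁⟩ := h₁
  obtain ⟨H₂, hs₂, hm₂⟩ := h₂
  obtain h | ⟨x, hx⟩ := (C₂ \ C₁).eq_empty_or_nonempty
  · rw [sdiff_eq_empty_iff_subset] at h
    rw [union_eq_left.2 h]
    exact ⟨H₁, hs₁, hm₁⟩
  obtain h | ⟨y, hy⟩ := (C₁ \ C₂).eq_empty_or_nonempty
  · rw [sdiff_eq_empty_iff_subset] at h
    rw [union_eq_right.2 h]
    exact ⟨H₂, hs₂, hm₂⟩
  refine ⟨H₁ ⊓ H₂, fun g hg => ?_, ?_⟩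
  · rw [mem_stabilizer_iff, smul_finset_union, hs₁ hg.1, hs₂ hg.2]
  have d₁ := card_sdiff_of_mem_sdiff hs₁ hs₂ hx
  have d₂ := card_sdiff_of_mem_sdiff hs₂ hs₁ hy
  rw [inf_comm] at d₂
  have e₁ : #(C₂ \ C₁) + #C₁ = #(C₁ ∪ C₂) := by rw [card_sdiff_add_card, union_comm]
  have e₂ : #(C₁ \ C₂) + #C₂ = #(C₁ ∪ C₂) := card_sdiff_add_card _ _
  omega

/-- Iterating Dyson transforms that fix `a ∈ A` and `b ∈ B` yields a periodic piece of `A * B`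
containing `a * b`. -/
theorem exists_subset_mul_le_card_add_card [DecidableEq G] {A B : Finset G} {a b : G}
    (ha : a ∈ A) (hb : b ∈ B) :
    ∃ C ⊆ A * B, a * b ∈ C ∧ ∃ H ≤ stabilizer G C, #A + #B ≤ #C + Nat.card H := by
  classical
  induction hn : #B using Nat.strong_induction_on generalizing A B with
  | _ n ih =>
  subst hn
  by_cases hAB : ∀ e ∈ A, B ⊆ (e * b⁻¹)⁻¹ • A
  · refine ⟨b • A, ?_, ?_, stabilizer G A, ?_, ?_⟩
    · intro c hc
      obtain ⟨g, hg, rfl⟩ := mem_smul_finset.1 hc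
      rw [smul_eq_mul, mul_comm b g]
      exact mul_mem_mul hg hb
    · rw [mul_comm]
      exact smul_mem_smul_finset ha
    · intro g hg
      rw [mem_stabilizer_iff, smul_comm, hg]
    · rw [card_smul_finset, ← Subgroup.card_filter_mem_eq]
      refine Nat.add_le_add_left (card_le_card_of_injOn (fun y => b⁻¹ * y) (fun y hy => ?_)
        (fun _ _ _ _ h => mul_left_cancel h)) _
      simp only [coe_filter, mem_univ, true_and, Set.mem_ofPred_eq, mem_stabilizer_finset']
      intro e he
      have := hAB e he hy
      rw [mem_inv_smul_finset_iff, smul_eq_mul] at this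
      rwa [smul_eq_mul, mul_comm, ← mul_assoc]
  · push Not at hAB
    obtain ⟨e, he, hne⟩ := hAB
    have hb' : b ∈ (mulDysonETransform (e * b⁻¹) (A, B)).2 := by
      rw [mulDysonETransform_snd, mem_inter, mem_inv_smul_finset_iff]
      simpa using ⟨hb, he⟩
    have ha' : a ∈ (mulDysonETransform (e * b⁻¹) (A, B)).1 := by
      rw [mulDysonETransform_fst]
      exact mem_union_left _ ha
    have hlt : #(mulDysonETransform (e * b⁻¹) (A, B)).2 < #B := by
      rw [mulDysonETransform_snd]
      refine card_lt_card (ssubset_of_subset_of_ne inter_subset_left fun h => hne ?_)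
      exact inter_eq_left.1 h
    obtain ⟨C, hC, hab, H, hH, hcard⟩ := ih _ hlt ha' hb' rfl
    rw [mulDysonETransform.card] at hcard
    exact ⟨C, hC.trans (mulDysonETransform.subset _ _), hab, H, hH, hcard⟩

/-- **Kneser's theorem** in a finite abelian group. -/
theorem exists_card_add_card_le_card_mul_add_card [DecidableEq G] {A B : Finset G}
    (hA : A.Nonempty) (hB : B.Nonempty) :
    ∃ H ≤ stabilizer G (A * B), #A + #B ≤ #(A * B) + Nat.card H := by
  have h : ∀ x ∈ A * B, ∃ C ⊆ A * B, x ∈ C ∧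
      ∃ H ≤ stabilizer G C, #A + #B ≤ #C + Nat.card H := by
    intro x hx
    obtain ⟨a, ha, b, hb, rfl⟩ := mem_mul.1 hx
    exact exists_subset_mul_le_card_add_card ha hb
  choose! f hf using h
  have hsup : (A * B).sup' (hA.mul hB) f = A * B := by
    refine le_antisymm (sup'_le _ _ fun x hx => (hf x hx).1) fun x hx => ?_
    exact le_sup' f hx (hf x hx).2.1
  rw [← hsup]
  exact sup'_induction
    (p := fun C => ∃ H ≤ stabilizer G C, #A + #B ≤ #C + Nat.card H) (hA.mul hB) f
    (fun _ h₁ _ h₂ => exists_le_card_union_add_card h₁ h₂) fun x hx => (hf x hx).2.2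

end Kneser

theorem Nat.exists_prime_dvd_mod_three_eq_two {m : ℕ} (hm : m % 3 = 2) :
    ∃ q, q.Prime ∧ q % 3 = 2 ∧ q ∣ m := by
  induction m using Nat.strong_induction_on with
  | _ m ih =>
  obtain ⟨q, hq, t, rfl⟩ := Nat.exists_prime_and_dvd (n := m) (by omega)
  have h3 : q % 3 < 3 := Nat.mod_lt _ (by norm_num)
  rw [Nat.mul_mod] at hm
  interval_cases h : q % 3
  · simp at hm
  · have ht : t % 3 = 2 := by simpa using hm
    obtain ⟨r, hr, hr3, hrt⟩ := ih t (lt_mul_left (by omega) hq.one_lt) ht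
    exact ⟨r, hr, hr3, hrt.mul_left q⟩
  · exact ⟨q, hq, h, dvd_mul_right q t⟩

section ProductFree

variable {G : Type*} [CommGroup G] [Fintype G]

/-- A product-free set is covered by `r` cosets of a subgroup `H` with `3 r ≤ [G : H] + 1`. -/
theorem IsProductFree.exists_subgroup_card_le {A : Finset G} (hA : IsProductFree A)
    (hne : A.Nonempty) :
    ∃ (H : Subgroup G) (r : ℕ), 3 * r ≤ Nat.card (G ⧸ H) + 1 ∧ #A ≤ Nat.card H * r := by
  classical
  set H := stabilizer G (A * A)
  set A' : Finset G := A * ({g | g ∈ H} : Finset G) with hA'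
  have hsub : A ⊆ A' := subset_mul_left A (by simp [H.one_mem])
  have hmul : A' * A' = A * A := by
    refine subset_antisymm (fun z hz => ?_) (mul_subset_mul hsub hsub)
    obtain ⟨_, hx, _, hy, rfl⟩ := mem_mul.1 hz
    obtain ⟨a, ha, h, hh, rfl⟩ := mem_mul.1 hx
    obtain ⟨b, hb, k, hk, rfl⟩ := mem_mul.1 hy
    have hhk : h * k ∈ H := H.mul_mem (by simpa using hh) (by simpa using hk)
    rw [mul_mul_mul_comm, mul_comm (a * b)]
    exact mem_stabilizer_finset'.1 hhk (mul_mem_mul ha hb)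
  have hdisj : Disjoint A' (A * A) := by
    refine disjoint_left.2 fun z hz hz' => ?_
    obtain ⟨a, ha, h, hh, rfl⟩ := mem_mul.1 hz
    have hh' : h ∈ H := by simpa using hh
    have haA : a ∈ A * A := by
      rw [mul_comm a h] at hz'
      exact (mem_stabilizer_finset.1 hh' a).1 hz'
    obtain ⟨b, hb, c, hc, hbc⟩ := mem_mul.1 haA
    exact hA b hb c hc a ha hbc
  obtain ⟨K, hK, hcard⟩ :=
    exists_card_add_card_le_card_mul_add_card (hne.mono hsub) (hne.mono hsub)
  rw [hmul] at hK hcard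
  have hKH : Nat.card K ≤ Nat.card H := Subgroup.card_le_of_le hK
  have hle : #A' + #(A * A) ≤ Nat.card G := by
    rw [← card_union_of_disjoint hdisj, Nat.card_eq_fintype_card]
    exact card_le_univ _
  have hA'card : #A' = Nat.card H * Nat.card (((↑) : G → G ⧸ H) '' (A : Set G)) := by
    rw [← Subgroup.card_mul_eq_card_subgroup_mul_card_quotient,
      show (A : Set G) * (H : Set G) = (A' : Set G) by ext; simp [hA', Set.mem_mul]]
    simp
  refine ⟨H, _, ?_, (card_le_card hsub).trans hA'card.le⟩
  rw [Subgroup.card_eq_card_quotient_mul_card_subgroup H] at hle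
  have hpos : 0 < Nat.card H := Nat.card_pos
  exact le_of_mul_le_mul_left (by nlinarith) hpos

theorem IsProductFree.three_mul_card_le {p : ℕ}
    (hleast : ∀ q : ℕ, q.Prime → q % 3 = 2 → q ∣ Fintype.card G → p ≤ q) {A : Finset G}
    (hA : IsProductFree A) : 3 * p * #A ≤ Fintype.card G * (p + 1) := by
  obtain rfl | hne := A.eq_empty_or_nonempty
  · simp
  obtain ⟨H, r, hr, hcard⟩ := hA.exists_subgroup_card_le hne
  rw [← Nat.card_eq_fintype_card] at hleast ⊢
  have hn := Subgroup.card_eq_card_quotient_mul_card_subgroup H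
  rw [hn] at hleast ⊢
  generalize Nat.card (G ⧸ H) = m at *
  have key : 3 * p * r ≤ m * (p + 1) := by
    by_cases hm : m % 3 = 2
    · obtain ⟨q, hq, hq3, hqm⟩ := Nat.exists_prime_dvd_mod_three_eq_two hm
      have hpm : p ≤ m := (hleast q hq hq3 (hqm.mul_right _)).trans
        (Nat.le_of_dvd (by omega) hqm)
      nlinarith
    · have : 3 * r ≤ m := by omega
      nlinarith
  calc 3 * p * #A ≤ 3 * p * (Nat.card H * r) := by gcongr
    _ = Nat.card H * (3 * p * r) := by ring
    _ ≤ Nat.card H * (m * (p + 1)) := by gcongr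
    _ = m * Nat.card H * (p + 1) := by ring

theorem AddCommGroup.exists_zmod_apply_ne_zero {p : ℕ} [Fact p.Prime] {V : Type*} [AddCommGroup V]
    (h : ∀ x : V, p • x = 0) {v : V} (hv : v ≠ 0) : ∃ φ : V →+ ZMod p, φ v ≠ 0 := by
  have : Module (ZMod p) V := AddCommGroup.zmodModule h
  obtain ⟨φ, hφ⟩ := Module.Projective.exists_dual_ne_zero (ZMod p) hv
  exact ⟨φ.toAddMonoidHom, hφ⟩

/-- A finite abelian group of order divisible by `p` surjects onto `ℤ/pℤ`. -/
theorem CommGroup.exists_surjective_zmod {p : ℕ} (hp : p.Prime) (hpn : p ∣ Fintype.card G) :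
    ∃ f : G →* Multiplicative (ZMod p), Function.Surjective f := by
  have : Fact p.Prime := ⟨hp⟩
  set N := (powMonoidHom p : G →* G).range
  have hNtop : ∃ g : G, g ∉ N := by
    by_contra! h
    have hinj : Function.Injective (powMonoidHom p : G →* G) :=
      Finite.injective_iff_surjective.2 fun g => h g
    obtain ⟨g, hg⟩ := exists_prime_orderOf_dvd_card p hpn
    have h1 : g = 1 := hinj (by simp [← hg, pow_orderOf_eq_one])
    rw [h1, orderOf_one] at hg
    exact hp.one_lt.ne hg
  obtain ⟨g, hg⟩ := hNtop
  have htor : ∀ x : Additive (G ⧸ N), p • x = 0 := fun x => by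
    induction x using Additive.rec with | _ x
    induction x using QuotientGroup.induction_on with | _ x
    rw [← ofMul_pow, ← QuotientGroup.mk_pow]
    exact congrArg Additive.ofMul ((QuotientGroup.eq_one_iff _).2 ⟨x, rfl⟩)
  have hne : Additive.ofMul (g : G ⧸ N) ≠ 0 := fun h =>
    hg ((QuotientGroup.eq_one_iff g).1 (Additive.ofMul.injective h))
  obtain ⟨φ, hφ⟩ := AddCommGroup.exists_zmod_apply_ne_zero htor hne
  refine ⟨(AddMonoidHom.toMultiplicativeRight φ).comp (QuotientGroup.mk' N),
    fun y => ?_⟩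
  refine ⟨g ^ (y.toAdd * (φ (Additive.ofMul (g : G ⧸ N)))⁻¹).val, ?_⟩
  rw [map_pow]
  apply Multiplicative.toAdd.injective
  rw [toAdd_pow]
  change (_ : ℕ) • φ (Additive.ofMul (g : G ⧸ N)) = _
  rw [nsmul_eq_mul, ZMod.natCast_val, ZMod.cast_id, inv_mul_cancel_right₀ hφ]

/-- The middle third of `ℤ/pℤ`, pulled back to `G`, is product-free. -/
theorem exists_isProductFree_three_mul_card {p : ℕ} (hp : p.Prime) (hp2 : p % 3 = 2)
    (hpn : p ∣ Fintype.card G) :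
    ∃ S : Finset G, IsProductFree S ∧ 3 * p * #S = Fintype.card G * (p + 1) := by
  classical
  have : Fact p.Prime := ⟨hp⟩
  obtain ⟨f, hf⟩ := CommGroup.exists_surjective_zmod hp hpn
  obtain ⟨k, rfl⟩ : ∃ k, p = 3 * k + 2 := ⟨p / 3, by omega⟩
  set M : Finset (Multiplicative (ZMod (3 * k + 2))) :=
    {y | y.toAdd.val ∈ Icc (k + 1) (2 * k + 1)} with hM
  have hMcard : #M = k + 1 := by
    have : #M = #(Icc (k + 1) (2 * k + 1)) := by
      refine card_nbij' (fun y => y.toAdd.val) (fun n => Multiplicative.ofAdd (n : ZMod _))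
        (fun y hy => by simpa [hM] using hy) (fun n hn => ?_) (fun y _ => by simp) (fun n hn => ?_)
      all_goals
        simp only [coe_Icc, Set.mem_Icc] at hn
        have hval : (n : ZMod (3 * k + 2)).val = n := ZMod.val_cast_of_lt (by omega)
      · simpa [hM, hval] using hn
      · simpa using hval
    rw [this, Nat.card_Icc]
    omega
  have hfib : ∀ y, #{x | f x = y} = #{x | f x = 1} := fun y =>
    MonoidHom.card_fiber_eq_of_mem_range f (hf y) (hf 1)
  refine ⟨({x | f x ∈ M} : Finset G), fun a ha b hb c hc habc => ?_, ?_⟩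
  · simp only [hM, mem_filter, mem_univ, true_and, mem_Icc] at ha hb hc
    rw [← habc, map_mul, toAdd_mul, ZMod.val_add] at hc
    rcases Nat.lt_or_ge ((f a).toAdd.val + (f b).toAdd.val) (3 * k + 2) with h | h
    · rw [Nat.mod_eq_of_lt h] at hc
      omega
    · rw [Nat.mod_eq_sub_mod h, Nat.mod_eq_of_lt (by omega)] at hc
      omega
  · have hS : #({x | f x ∈ M} : Finset G) = (k + 1) * #{x | f x = 1} := by
      rw [← sum_card_fiberwise_eq_card_filter, sum_congr rfl fun y _ => hfib y, sum_const, hMcard,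
        smul_eq_mul]
    have hG : Fintype.card G = (3 * k + 2) * #{x | f x = 1} := by
      rw [← card_univ, card_eq_sum_card_fiberwise (f := f) (t := univ) (by simp),
        sum_congr rfl fun y _ => hfib y, sum_const, smul_eq_mul, card_univ]
      simp [ZMod.card]
    rw [hS, hG]
    ring

end ProductFree

/-- Green–Ruzsa, case (a): if `G` is a finite abelian group of order `n > 1`
divisible by a prime `p ≡ 2 (mod 3)`, and `p` is the least such prime, then
`α(G) = n/3 + n/(3p)`. -/
theorem green_ruzsa_case_a {G : Type*} [CommGroup G] [Fintype G]
    (hn : 1 < Fintype.card G) (p : ℕ) (hp : p.Prime) (hp2 : p % 3 = 2)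
    (hpn : p ∣ Fintype.card G)
    (hleast : ∀ q : ℕ, q.Prime → q % 3 = 2 → q ∣ Fintype.card G → p ≤ q) :
    (alphaPF G : ℚ) = Fintype.card G / 3 + Fintype.card G / (3 * p) := by
  obtain ⟨S, hS, hcard⟩ := exists_isProductFree_three_mul_card hp hp2 hpn
  have hα : alphaPF G = #S := by
    refine IsGreatest.csSup_eq ⟨⟨S, hS, rfl⟩, ?_⟩
    rintro _ ⟨A, hA, rfl⟩
    refine le_of_mul_le_mul_left ((hA.three_mul_card_le hleast).trans hcard.ge) ?_
    have := hp.pos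
    positivity
  have hp0 : (p : ℚ) ≠ 0 := by exact_mod_cast hp.ne_zero
  have hQ : (3 * p * #S : ℚ) = Fintype.card G * (p + 1) := by exact_mod_cast hcard
  rw [hα]
  field_simp
  linarith
end

section
/- (Green–Ruzsa, case (c)) Let G be a finite abelian group of order n > 1. If no prime congruent to 2 modulo 3 divides n and 3 does not divide n, then α(G) = n/3 − n/(3m) (an equality of rational numbers), where m is the exponent of G (the largest order of any element of G). -/
open Real

/-! ### Taylor bounds for the cosine -/

lemma le_of_hasDerivAt_le {f g f' g' : ℝ → ℝ} (hf : ∀ x, HasDerivAt f (f' x) x)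
    (hg : ∀ x, HasDerivAt g (g' x) x) (h0 : f 0 = g 0) (h : ∀ x, 0 ≤ x → f' x ≤ g' x)
    {x : ℝ} (hx : 0 ≤ x) : f x ≤ g x := by
  have hmono : MonotoneOn (fun y => g y - f y) (Set.Ici 0) := by
    refine monotoneOn_of_deriv_nonneg (convex_Ici 0) ?_ ?_ ?_
    · exact fun y _ => ((hg y).sub (hf y)).continuousAt.continuousWithinAt
    · exact fun y _ => ((hg y).sub (hf y)).differentiableAt.differentiableWithinAt
    · intro y hy
      rw [interior_Ici] at hy
      have := ((hg y).sub (hf y)).deriv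
      change deriv (fun y => g y - f y) y = _ at this
      rw [this]
      linarith [h y (le_of_lt hy)]
  have := hmono Set.self_mem_Ici (Set.mem_Ici.2 hx) hx
  simp only [h0, sub_self] at this
  linarith

lemma cos_ge_quadratic (x : ℝ) : 1 - x ^ 2 / 2 ≤ cos x := Real.one_sub_sq_div_two_le_cos

lemma sin_ge_cubic {x : ℝ} (hx : 0 ≤ x) : x - x ^ 3 / 6 ≤ sin x := by
  refine le_of_hasDerivAt_le (f := fun x => x - x ^ 3 / 6) (f' := fun x => 1 - x ^ 2 / 2)
    (fun y => ?_) hasDerivAt_sin (by simp) (fun y _ => cos_ge_quadratic y) hx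
  refine ((hasDerivAt_id' y).sub ((hasDerivAt_pow 3 y).div_const 6)).congr_deriv ?_
  norm_num; ring

lemma cos_le_quartic {x : ℝ} (hx : 0 ≤ x) : cos x ≤ 1 - x ^ 2 / 2 + x ^ 4 / 24 := by
  refine le_of_hasDerivAt_le (g := fun x => 1 - x ^ 2 / 2 + x ^ 4 / 24)
    (g' := fun x => -(x - x ^ 3 / 6)) hasDerivAt_cos (fun y => ?_) (by simp)
    (fun y hy => neg_le_neg (sin_ge_cubic hy)) hx
  refine (((hasDerivAt_const y 1).sub ((hasDerivAt_pow 2 y).div_const 2)).add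
    ((hasDerivAt_pow 4 y).div_const 24)).congr_deriv ?_
  norm_num; ring

lemma sin_le_quintic {x : ℝ} (hx : 0 ≤ x) : sin x ≤ x - x ^ 3 / 6 + x ^ 5 / 120 := by
  refine le_of_hasDerivAt_le (g := fun x => x - x ^ 3 / 6 + x ^ 5 / 120)
    (g' := fun x => 1 - x ^ 2 / 2 + x ^ 4 / 24) hasDerivAt_sin (fun y => ?_) (by simp)
    (fun y hy => cos_le_quartic hy) hx
  refine (((hasDerivAt_id' y).sub ((hasDerivAt_pow 3 y).div_const 6)).add
    ((hasDerivAt_pow 5 y).div_const 120)).congr_deriv ?_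
  norm_num; ring

lemma cos_ge_sextic {x : ℝ} (hx : 0 ≤ x) :
    1 - x ^ 2 / 2 + x ^ 4 / 24 - x ^ 6 / 720 ≤ cos x := by
  refine le_of_hasDerivAt_le (f := fun x => 1 - x ^ 2 / 2 + x ^ 4 / 24 - x ^ 6 / 720)
    (f' := fun x => -(x - x ^ 3 / 6 + x ^ 5 / 120)) (fun y => ?_) hasDerivAt_cos (by simp)
    (fun y hy => neg_le_neg (sin_le_quintic hy)) hx
  refine ((((hasDerivAt_const y 1).sub ((hasDerivAt_pow 2 y).div_const 2)).add
    ((hasDerivAt_pow 4 y).div_const 24)).sub ((hasDerivAt_pow 6 y).div_const 720)).congr_deriv ?_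
  norm_num; ring

lemma sin_ge_septic {x : ℝ} (hx : 0 ≤ x) :
    x - x ^ 3 / 6 + x ^ 5 / 120 - x ^ 7 / 5040 ≤ sin x := by
  refine le_of_hasDerivAt_le (f := fun x => x - x ^ 3 / 6 + x ^ 5 / 120 - x ^ 7 / 5040)
    (f' := fun x => 1 - x ^ 2 / 2 + x ^ 4 / 24 - x ^ 6 / 720) (fun y => ?_) hasDerivAt_sin
    (by simp) (fun y hy => cos_ge_sextic hy) hx
  refine ((((hasDerivAt_id' y).sub ((hasDerivAt_pow 3 y).div_const 6)).add
    ((hasDerivAt_pow 5 y).div_const 120)).sub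
    ((hasDerivAt_pow 7 y).div_const 5040)).congr_deriv ?_
  norm_num; ring

lemma cos_le_octic {x : ℝ} (hx : 0 ≤ x) :
    cos x ≤ 1 - x ^ 2 / 2 + x ^ 4 / 24 - x ^ 6 / 720 + x ^ 8 / 40320 := by
  refine le_of_hasDerivAt_le
    (g := fun x => 1 - x ^ 2 / 2 + x ^ 4 / 24 - x ^ 6 / 720 + x ^ 8 / 40320)
    (g' := fun x => -(x - x ^ 3 / 6 + x ^ 5 / 120 - x ^ 7 / 5040)) hasDerivAt_cos (fun y => ?_)
    (by simp) (fun y hy => neg_le_neg (sin_ge_septic hy)) hx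
  refine (((((hasDerivAt_const y 1).sub ((hasDerivAt_pow 2 y).div_const 2)).add
    ((hasDerivAt_pow 4 y).div_const 24)).sub ((hasDerivAt_pow 6 y).div_const 720)).add
    ((hasDerivAt_pow 8 y).div_const 40320)).congr_deriv ?_
  norm_num; ring

/-! ### The cosine on `ZMod q` -/

/-- The real part of the standard character of `ZMod q`. -/
noncomputable def zcos (q : ℕ) (j : ZMod q) : ℝ := cos (2 * π * j.val / q)

lemma zcos_intCast (q : ℕ) [NeZero q] (n : ℤ) : zcos q n = cos (2 * π * n / q) := by
  have hq : (q : ℝ) ≠ 0 := Nat.cast_ne_zero.2 (NeZero.ne q)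
  have hval : (((n : ZMod q).val : ℤ) : ℝ) = ((n % q : ℤ) : ℝ) := by rw [ZMod.val_intCast]
  have hdiv : (n : ℝ) = q * ((n / q : ℤ) : ℝ) + ((n % q : ℤ) : ℝ) := by
    exact_mod_cast (Int.mul_ediv_add_emod n q).symm
  rw [zcos, ← Real.cos_add_int_mul_two_pi _ (n / q)]
  congr 1
  rw [Int.cast_natCast] at hval
  rw [hval, hdiv]
  field_simp
  ring

lemma zcos_natCast (q : ℕ) [NeZero q] (n : ℕ) : zcos q n = cos (2 * π * n / q) := by
  simpa using zcos_intCast q n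

lemma zcos_neg {q : ℕ} [NeZero q] (j : ZMod q) : zcos q (-j) = zcos q j := by
  obtain ⟨n, rfl⟩ := ZMod.intCast_surjective j
  rw [← Int.cast_neg, zcos_intCast, zcos_intCast, ← Real.cos_neg]
  congr 1
  push_cast
  ring

lemma zcos_add_add_zcos_sub {q : ℕ} [NeZero q] (a b : ZMod q) :
    zcos q (a + b) + zcos q (a - b) = 2 * zcos q a * zcos q b := by
  obtain ⟨m, rfl⟩ := ZMod.intCast_surjective a
  obtain ⟨n, rfl⟩ := ZMod.intCast_surjective b
  rw [← Int.cast_add, ← Int.cast_sub]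
  simp only [zcos_intCast]
  push_cast
  rw [show 2 * π * ((m : ℝ) + n) / q = 2 * π * m / q + 2 * π * n / q by ring,
    show 2 * π * ((m : ℝ) - n) / q = 2 * π * m / q - 2 * π * n / q by ring, cos_add, cos_sub]
  ring

/-! ### Profiles of sum-free sets along a cyclic quotient -/

/-- The properties of the density function `α j` of a sum-free set on the fibres of a homomorphism
onto `ZMod q` along which the set has a large negative Fourier coefficient. -/
structure IsSumFreeProfile (q : ℕ) [NeZero q] (α : ZMod q → ℝ) : Prop where
  nonneg : ∀ j, 0 ≤ α j
  pair : ∀ s j, α s ≠ 0 → α j + α (j + s) ≤ 1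
  triple : ∀ a b, α a ≠ 0 → α b ≠ 0 → α (a + b) ≠ 0 → α a + α b + α (a + b) ≤ 8 / 7
  sum_lt : ∑ j, α j < q
  spectral : (∑ j, α j) ^ 2 ≤ -((q - ∑ j, α j) * ∑ j, α j * zcos q j)

namespace IsSumFreeProfile

variable {q : ℕ} [NeZero q] {α : ZMod q → ℝ}

lemma comp_neg (h : IsSumFreeProfile q α) : IsSumFreeProfile q (fun j => α (-j)) where
  nonneg j := h.nonneg _
  pair s j hs := by
    have := h.pair (-s) (-j) hs
    rwa [← neg_add] at this
  triple a b ha hb hab := by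
    rw [neg_add] at hab ⊢
    exact h.triple _ _ ha hb hab
  sum_lt := by
    have h1 : ∑ j, α (-j) = ∑ j, α j := Equiv.sum_comp (Equiv.neg (ZMod q)) α
    rw [h1]
    exact h.sum_lt
  spectral := by
    have h1 : ∑ j, α (-j) = ∑ j, α j := Equiv.sum_comp (Equiv.neg (ZMod q)) α
    have h2 : ∑ j, α (-j) * zcos q j = ∑ j, α j * zcos q j := by
      rw [← Equiv.sum_comp (Equiv.neg (ZMod q)) (fun j => α j * zcos q j)]
      simp [zcos_neg]
    rw [h1, h2]
    exact h.spectral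

lemma add_double_le (h : IsSumFreeProfile q α) (j : ZMod q) : α j + α (2 * j) ≤ 1 := by
  rw [two_mul]
  by_cases hj : α j = 0
  · by_cases hj2 : α (j + j) = 0
    · rw [hj, hj2]; norm_num
    · have := h.pair (j + j) 0 hj2
      have h0 := h.nonneg 0
      rw [zero_add] at this
      linarith
  · exact h.pair j j hj

/-- A profile of large total mass correlates strongly with the cosine. -/
lemma mass_le (h : IsSumFreeProfile q α) {k : ℕ} (hq : q = 6 * k + 1)
    (hσ : 2 * (k : ℝ) < ∑ j, α j) :
    2 * k * ∑ j, α j ≤ -((4 * k + 1) * ∑ j, α j * zcos q j) := by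
  have h1 := h.spectral
  have h2 := h.sum_lt
  have hqr : (q : ℝ) = 6 * k + 1 := by rw [hq]; push_cast; ring
  rw [hqr] at h1 h2
  set σ := ∑ j, α j
  set F := ∑ j, α j * zcos q j
  have hk : (0 : ℝ) ≤ k := Nat.cast_nonneg k
  have hσ0 : 0 < σ := by linarith
  have hF : F < 0 := by
    by_contra hF
    push Not at hF
    nlinarith [mul_nonneg (sub_nonneg.2 h2.le) hF, pow_pos hσ0 2]
  have : (2 * k * σ + (4 * k + 1) * F) * σ ≤ 0 := by
    nlinarith [mul_nonneg (sub_nonneg.2 hσ.le) (neg_nonneg.2 hF.le),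
      mul_nonneg (sub_nonneg.2 hσ.le) hσ0.le]
  nlinarith [nonpos_of_mul_nonpos_left this hσ0]

end IsSumFreeProfile

/-- Weak linear programming duality for the shift and doubling constraints. -/
lemma sum_mul_le_of_cover {q : ℕ} [NeZero q] (hq : Odd q) {α w u d : ZMod q → ℝ} (i : ZMod q)
    (hα : ∀ j, 0 ≤ α j) (hu : ∀ j, 0 ≤ u j) (hd : ∀ j, 0 ≤ d j)
    (hshift : ∀ j, u j ≠ 0 → α j + α (j + i) ≤ 1) (hdouble : ∀ j, α j + α (2 * j) ≤ 1)
    (hcover : ∀ j, α (2 * j) ≠ 0 → w (2 * j) ≤ u (2 * j) + u (2 * j - i) + d (2 * j) + d j) :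
    ∑ j, α j * w j ≤ ∑ j, u j + ∑ j, d j := by
  have h2 : IsUnit (2 : ZMod q) := by
    have := (ZMod.isUnit_iff_coprime 2 q).2 (Nat.coprime_two_left.2 hq)
    simpa using this
  have hbij : Function.Bijective (fun j : ZMod q => 2 * j) := IsUnit.isUnit_iff_mulLeft_bijective.1 h2
  let e : ZMod q ≃ ZMod q := Equiv.ofBijective _ hbij
  have he : ∀ f : ZMod q → ℝ, ∑ j, f (2 * j) = ∑ j, f j := fun f => Equiv.sum_comp e f
  have hs : ∑ j, α j * u (j - i) = ∑ j, α (j + i) * u j := by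
    rw [← Equiv.sum_comp (Equiv.addRight i)]
    simp
  calc ∑ j, α j * w j = ∑ j, α (2 * j) * w (2 * j) := (he fun j => α j * w j).symm
    _ ≤ ∑ j, (α (2 * j) * u (2 * j) + α (2 * j) * u (2 * j - i) + α (2 * j) * d (2 * j)
          + α (2 * j) * d j) := by
        refine Finset.sum_le_sum fun j _ => ?_
        by_cases h0 : α (2 * j) = 0
        · simp [h0]
        · nlinarith [hcover j h0, hα (2 * j)]
    _ = ∑ j, (α j + α (j + i)) * u j + ∑ j, (α j + α (2 * j)) * d j := by
        simp only [Finset.sum_add_distrib, add_mul]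
        rw [he fun j => α j * u j, he fun j => α j * u (j - i), he fun j => α j * d j, hs]
        ring
    _ ≤ ∑ j, u j + ∑ j, d j := by
        refine add_le_add (Finset.sum_le_sum fun j _ => ?_) (Finset.sum_le_sum fun j _ => ?_)
        · by_cases h0 : u j = 0
          · simp [h0]
          · nlinarith [hshift j h0, hu j]
        · nlinarith [hdouble j, hd j]

/-- A profile supported on the residues `k < j ≤ 5k` has mass at most `2k`. -/
lemma IsSumFreeProfile.sum_le_of_support {q : ℕ} [NeZero q] {α : ZMod q → ℝ}
    (h : IsSumFreeProfile q α) {k : ℕ} (hq : q = 6 * k + 1)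
    (hsupp : ∀ j : ZMod q, α j ≠ 0 → k < j.val ∧ j.val ≤ 5 * k) :
    ∑ j, α j ≤ 2 * k := by
  classical
  let P : ℕ → Prop := fun n => (k + 1 ≤ n ∧ n ≤ 2 * k) ∨ (4 * k + 1 ≤ n ∧ n ≤ 5 * k)
  let d : ZMod q → ℝ := fun j => if P j.val then 1 else 0
  have hd : ∀ j, 0 ≤ d j := fun j => by simp only [d]; split_ifs <;> simp
  have key := sum_mul_le_of_cover (q := q) (α := α) (w := 1) (u := 0) (d := d)
    ⟨3 * k, by omega⟩ 0 h.nonneg (fun _ => le_rfl) hd (fun j hj => absurd rfl hj)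
    h.add_double_le (fun j hj => by
      have hmem : P (2 * j).val ∨ P j.val := by
        have h1 := hsupp _ hj
        have h2 : (2 * j).val = 2 * j.val % q := by
          rw [two_mul, ZMod.val_add, two_mul]
        have h3 := j.val_lt
        simp only [P]
        rw [h2] at h1 ⊢
        have h4 : 2 * j.val % q = 2 * j.val ∨ 2 * j.val % q + q = 2 * j.val := by
          rcases lt_or_ge (2 * j.val) q with h5 | h5
          · exact Or.inl (Nat.mod_eq_of_lt h5)
          · right
            rw [Nat.mod_eq_sub_mod h5, Nat.mod_eq_of_lt (by omega)]
            omega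
        omega
      have h5 := hd j
      have h6 := hd (2 * j)
      simp only [Pi.one_apply, Pi.zero_apply]
      rcases hmem with h7 | h7
      · have : d (2 * j) = 1 := if_pos h7
        linarith
      · have : d j = 1 := if_pos h7
        linarith)
  have hsum : ∑ j, d j = 2 * k := by
    subst hq
    have h1 : ∑ j, d j = ∑ n ∈ Finset.range (6 * k + 1), if P n then (1 : ℝ) else 0 := by
      rw [Finset.sum_range]
      rfl
    have h2 : (Finset.range (6 * k + 1)).filter P
        = Finset.Icc (k + 1) (2 * k) ∪ Finset.Icc (4 * k + 1) (5 * k) := by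
      ext n
      simp only [P, Finset.mem_filter, Finset.mem_range, Finset.mem_union, Finset.mem_Icc]
      omega
    have h3 : Disjoint (Finset.Icc (k + 1) (2 * k)) (Finset.Icc (4 * k + 1) (5 * k)) := by
      rw [Finset.disjoint_left]
      intro n
      simp only [Finset.mem_Icc]
      omega
    rw [h1, Finset.sum_boole, h2, Finset.card_union_of_disjoint h3, Nat.card_Icc, Nat.card_Icc]
    norm_cast
    omega
  simpa [hsum] using key

/-! ### The shift constraint alone -/

lemma sum_cos_arith (a : ℕ) (δ x : ℝ) (m : ℕ) :
    2 * sin x * ∑ n ∈ Finset.range m, cos ((2 * ((a + n : ℕ) : ℝ) + δ) * x)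
      = sin ((2 * (a + m) - 1 + δ) * x) - sin ((2 * a - 1 + δ) * x) := by
  induction m with
  | zero => simp
  | succ m ih =>
    rw [Finset.sum_range_succ, mul_add, ih]
    push_cast
    rw [show (2 * ((a : ℝ) + (m + 1)) - 1 + δ) * x = (2 * (a + m) + δ) * x + x by ring,
      show (2 * ((a : ℝ) + m) - 1 + δ) * x = (2 * (a + m) + δ) * x - x by ring,
      sin_add, sin_sub]
    ring

lemma sum_max_sub_cos_le {k q δ : ℕ} (hk : 1 ≤ k) (hq : q = 6 * k + 1) (hδ : δ ≤ 1) {x : ℝ}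
    (hx : q * x = π) :
    ∑ n ∈ Finset.range q, max 0 (cos ((2 * k + 1) * x) - cos ((2 * n + δ) * x))
      ≤ 4 * k * cos ((2 * k + 1) * x) + sin ((2 * k + 1) * x) / sin x := by
  have hqr : (q : ℝ) = 6 * k + 1 := by rw [hq]; push_cast; ring
  have hkr : (1 : ℝ) ≤ k := by exact_mod_cast hk
  have hx0 : 0 < x := by
    have : 0 < (q : ℝ) := by rw [hqr]; linarith
    have h1 := pi_pos
    rw [← hx] at h1
    exact pos_of_mul_pos_right h1 this.le
  have hpi : π = 6 * k * x + x := by rw [← hx, hqr]; ring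
  have hkx : x ≤ k * x := by nlinarith
  have hsx : 0 < sin x := sin_pos_of_pos_of_lt_pi hx0 (by linarith)
  have hδr : (δ : ℝ) ≤ 1 := by exact_mod_cast hδ
  have hδ0 : (0 : ℝ) ≤ δ := Nat.cast_nonneg δ
  have hδx : δ * x ≤ x := by nlinarith
  have hδx0 : 0 ≤ δ * x := by positivity
  set μ := cos ((2 * k + 1) * x) with hμ
  have hmid : ∀ n : ℕ, k + 1 ≤ n → n ≤ 5 * k → cos ((2 * n + δ) * x) ≤ μ := by
    intro n h1 h2
    have h1' : (k : ℝ) + 1 ≤ n := by exact_mod_cast h1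
    have h2' : (n : ℝ) ≤ 5 * k := by exact_mod_cast h2
    have h1x : (k + 1) * x ≤ n * x := by gcongr
    have h2x : (n : ℝ) * x ≤ 5 * k * x := by gcongr
    rcases le_or_gt ((2 * n + δ) * x) π with h | h
    · exact cos_le_cos_of_nonneg_of_le_pi (by positivity) h (by linarith)
    · rw [← cos_two_pi_sub]
      exact cos_le_cos_of_nonneg_of_le_pi (by positivity) (by linarith) (by linarith)
  have hlow : ∀ n : ℕ, n ≤ k → μ ≤ cos ((2 * n + δ) * x) := by
    intro n h1
    have h1' : (n : ℝ) ≤ k := by exact_mod_cast h1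
    have h1x : n * x ≤ k * x := by gcongr
    exact cos_le_cos_of_nonneg_of_le_pi (by positivity) (by linarith) (by linarith)
  have hhigh : ∀ n : ℕ, 5 * k + 1 ≤ n → n ≤ 6 * k → μ ≤ cos ((2 * n + δ) * x) := by
    intro n h1 h2
    have h1' : (5 : ℝ) * k + 1 ≤ n := by exact_mod_cast h1
    have h2' : (n : ℝ) ≤ 6 * k := by exact_mod_cast h2
    have h1x : (5 * k + 1) * x ≤ n * x := by gcongr
    have h2x : (n : ℝ) * x ≤ 6 * k * x := by gcongr
    rw [← cos_two_pi_sub]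
    exact cos_le_cos_of_nonneg_of_le_pi (by linarith) (by linarith) (by linarith)
  have hsplit : ∑ n ∈ Finset.range q, max 0 (μ - cos ((2 * n + δ) * x))
      = ∑ n ∈ Finset.Ico (k + 1) (5 * k + 1), (μ - cos ((2 * n + δ) * x)) := by
    rw [← Finset.sum_subset (s₁ := Finset.Ico (k + 1) (5 * k + 1))]
    · refine Finset.sum_congr rfl fun n hn => max_eq_right ?_
      rw [Finset.mem_Ico] at hn
      linarith [hmid n hn.1 (by omega)]
    · intro n hn
      rw [Finset.mem_Ico] at hn
      rw [Finset.mem_range]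
      omega
    · intro n hn hn'
      rw [Finset.mem_range] at hn
      rw [Finset.mem_Ico] at hn'
      refine max_eq_left ?_
      rcases le_or_gt n k with h | h
      · linarith [hlow n h]
      · linarith [hhigh n (by omega) (by omega)]
  rw [hsplit, Finset.sum_sub_distrib, Finset.sum_Ico_eq_sum_range, Finset.sum_Ico_eq_sum_range,
    show 5 * k + 1 - (k + 1) = 4 * k by omega]
  have hsum := sum_cos_arith (k + 1) δ x (4 * k)
  have hsin : sin ((2 * (((k + 1 : ℕ) : ℝ) + (4 * k : ℕ)) - 1 + δ) * x)
      = - sin ((2 * k + 1) * x - δ * x) := by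
    rw [← sin_neg, ← sin_add_two_pi (-_), hpi]
    congr 1
    push_cast
    ring
  have hsin' : sin ((2 * ((k + 1 : ℕ) : ℝ) - 1 + δ) * x) = sin ((2 * k + 1) * x + δ * x) := by
    congr 1
    push_cast
    ring
  rw [hsin, hsin', sin_sub, sin_add] at hsum
  have hS : ∑ n ∈ Finset.range (4 * k), cos ((2 * ((k + 1 + n : ℕ) : ℝ) + δ) * x)
      = - (sin ((2 * k + 1) * x) * cos (δ * x) / sin x) := by
    rw [← neg_div, eq_div_iff hsx.ne']
    linarith
  rw [hS]
  have hpos : 0 ≤ sin ((2 * k + 1) * x) :=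
    sin_nonneg_of_nonneg_of_le_pi (by positivity) (by linarith)
  have hle : sin ((2 * k + 1) * x) * cos (δ * x) / sin x ≤ sin ((2 * k + 1) * x) / sin x := by
    gcongr
    exact mul_le_of_le_one_right hpos (cos_le_one _)
  simp only [Finset.sum_const, Finset.card_range, nsmul_eq_mul]
  push_cast
  linarith

lemma sum_max_sub_zcos_le {k q : ℕ} [NeZero q] (hk : 1 ≤ k) (hq : q = 6 * k + 1) {x : ℝ}
    (hx : q * x = π) (i : ℕ) :
    ∑ j : ZMod q, max 0 (cos ((2 * k + 1) * x) - (-1) ^ i * zcos q j)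
      ≤ 4 * k * cos ((2 * k + 1) * x) + sin ((2 * k + 1) * x) / sin x := by
  have hqr : (q : ℝ) = 6 * k + 1 := by rw [hq]; push_cast; ring
  have hq0 : (q : ℝ) ≠ 0 := Nat.cast_ne_zero.2 (NeZero.ne q)
  have hx' : x = π / q := by field_simp; linarith
  have hsum : ∀ f : ℕ → ℝ, ∑ j : ZMod q, f j.val = ∑ n ∈ Finset.range q, f n := by
    intro f
    subst hq
    rw [Finset.sum_range]
    rfl
  rcases Nat.even_or_odd i with hi | hi
  · rw [hi.neg_one_pow]
    refine le_trans (le_of_eq ?_) (sum_max_sub_cos_le (δ := 0) hk hq (by norm_num) hx)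
    rw [← hsum]
    refine Finset.sum_congr rfl fun j _ => ?_
    rw [one_mul, zcos, hx']
    congr 3
    push_cast
    ring
  · rw [hi.neg_one_pow]
    refine le_trans (le_of_eq ?_) (sum_max_sub_cos_le (δ := 1) hk hq le_rfl hx)
    rw [← hsum, ← Equiv.sum_comp (Equiv.addRight (-(3 * k : ℤ) : ZMod q))]
    refine Finset.sum_congr rfl fun j _ => ?_
    have hz : zcos q (j + (-(3 * k : ℤ) : ZMod q)) = - cos ((2 * j.val + 1) * x) := by
      have : j + (-(3 * k : ℤ) : ZMod q) = ((j.val - 3 * k : ℤ) : ZMod q) := by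
        push_cast
        rw [ZMod.natCast_zmod_val]
        ring
      rw [this, zcos_intCast, ← cos_sub_pi]
      congr 1
      nth_rewrite 2 [← hx]
      rw [hx']
      field_simp
      rw [hqr]
      push_cast
      ring
    rw [Equiv.coe_addRight, Nat.cast_one]
    congr 1
    push_cast at hz ⊢
    rw [hz]
    ring

/-- A profile of mass exceeding `2k` vanishes at `i` as soon as `i` satisfies an explicit
trigonometric inequality. -/
lemma IsSumFreeProfile.eq_zero_of_sin_le {q : ℕ} [NeZero q] {α : ZMod q → ℝ}
    (h : IsSumFreeProfile q α) {k : ℕ} (hk : 1 ≤ k) (hq : q = 6 * k + 1)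
    (hσ : 2 * (k : ℝ) < ∑ j, α j) {i : ℕ} (hi : i ≤ k)
    (hsin : (4 * k + 1) * sin ((2 * k + 1) * (π / q))
      ≤ 8 * k ^ 2 * sin (π / q) * cos (i * (π / q))) : α i = 0 := by
  by_contra hα
  have hqr : (q : ℝ) = 6 * k + 1 := by rw [hq]; push_cast; ring
  have hkr : (1 : ℝ) ≤ k := by exact_mod_cast hk
  have hir : (i : ℝ) ≤ k := by exact_mod_cast hi
  have hq0 : (q : ℝ) ≠ 0 := Nat.cast_ne_zero.2 (NeZero.ne q)
  obtain ⟨x, hxdef⟩ : ∃ x, x = π / q := ⟨_, rfl⟩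
  have hx : q * x = π := by rw [hxdef]; field_simp
  rw [← hxdef] at hsin
  have hpi : π = 6 * k * x + x := by rw [← hx, hqr]; ring
  have hx0 : 0 < x := by rw [hxdef]; exact div_pos pi_pos (by rw [hqr]; linarith)
  have hkx : x ≤ k * x := by nlinarith
  have hix : i * x ≤ k * x := by gcongr
  have hsx : 0 < sin x := sin_pos_of_pos_of_lt_pi hx0 (by linarith)
  set μ := cos ((2 * k + 1) * x) with hμ
  have hμ0 : 0 ≤ μ := cos_nonneg_of_neg_pi_div_two_le_of_le (by nlinarith) (by linarith)
  set D := 2 * cos (i * x) with hD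
  have hD0 : 0 < D := by
    have : 0 < cos (i * x) := cos_pos_of_mem_Ioo ⟨by
      have : 0 ≤ i * x := by positivity
      linarith, by linarith⟩
    linarith
  set e : ZMod q := (((3 * k + 1) * i : ℕ) : ZMod q) with he
  have he2 : e + e = i := by
    have : e + e = ((q * i + i : ℕ) : ZMod q) := by
      rw [he, ← Nat.cast_add, hq]
      congr 1
      ring
    rw [this]
    simp
  have hce : 2 * zcos q e = (-1) ^ i * D := by
    rw [he, zcos_natCast]
    have : 2 * π * (((3 * k + 1) * i : ℕ) : ℝ) / q = i * x + i * π := by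
      rw [hxdef]
      field_simp
      rw [hqr]
      push_cast
      ring
    rw [this, cos_add_nat_mul_pi, hD]
    ring
  have hsq : ((-1 : ℝ) ^ i) * (-1) ^ i = 1 := by
    rw [← mul_pow]
    norm_num
  set u : ZMod q → ℝ := fun j => max 0 (μ - (-1) ^ i * zcos q (j + e)) / D with hu
  have key := sum_mul_le_of_cover (q := q) (α := α) (w := fun j => 2 * μ / D - zcos q j)
    (u := u) (d := 0) ⟨3 * k, by omega⟩ i h.nonneg
    (fun j => div_nonneg (le_max_left _ _) hD0.le) (fun _ => le_rfl)
    (fun j _ => h.pair _ _ hα) h.add_double_le (fun j _ => by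
      obtain ⟨t, ht⟩ : ∃ t, t = 2 * j := ⟨_, rfl⟩
      rw [← ht]
      have h1 : (μ - (-1) ^ i * zcos q (t + e)) / D ≤ u t :=
        div_le_div_of_nonneg_right (le_max_right _ _) hD0.le
      have h2 : (μ - (-1) ^ i * zcos q (t - e)) / D ≤ u (t - i) := by
        have : t - (i : ZMod q) + e = t - e := by rw [← he2]; ring
        simp only [hu, this]
        exact div_le_div_of_nonneg_right (le_max_right _ _) hD0.le
      have h3 := zcos_add_add_zcos_sub t e
      have h4 : (μ - (-1) ^ i * zcos q (t + e)) / D + (μ - (-1) ^ i * zcos q (t - e)) / D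
          = 2 * μ / D - zcos q t := by
        field_simp
        linear_combination (-(-1) ^ i) * h3 - (-1) ^ i * zcos q t * hce - zcos q t * D * hsq
      simp only [Pi.zero_apply]
      linarith)
  have hU : ∑ j, u j ≤ (4 * k * μ + sin ((2 * k + 1) * x) / sin x) / D := by
    simp only [hu]
    rw [← Finset.sum_div]
    refine div_le_div_of_nonneg_right ?_ hD0.le
    refine le_trans (le_of_eq ?_) (sum_max_sub_zcos_le hk hq hx i)
    exact Equiv.sum_comp (Equiv.addRight e) fun j => max 0 (μ - (-1) ^ i * zcos q j)
  have hmass := h.mass_le hq hσ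
  simp only [mul_sub, Finset.sum_sub_distrib, Pi.zero_apply, Finset.sum_const_zero, add_zero,
    ← Finset.sum_mul] at key
  set σ := ∑ j, α j
  set F := ∑ j, α j * zcos q j
  have hfin : (4 * k * μ + sin ((2 * k + 1) * x) / sin x) / D
      ≤ 2 * k * (2 * μ / D) + 2 * k * (2 * k / (4 * k + 1)) := by
    have h1 : sin ((2 * k + 1) * x) / sin x ≤ 4 * k ^ 2 * D / (4 * k + 1) := by
      rw [div_le_div_iff₀ hsx (by positivity), hD]
      linarith
    calc _ ≤ (4 * k * μ + 4 * k ^ 2 * D / (4 * k + 1)) / D := by gcongr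
      _ = _ := by field_simp; ring
  have hF : 2 * k / (4 * k + 1) * σ ≤ - F := by
    rw [div_mul_eq_mul_div, div_le_iff₀ (by positivity)]
    linarith
  have hρ : (0 : ℝ) < 2 * k / (4 * k + 1) := by positivity
  have hμD : 0 ≤ 2 * μ / D := by positivity
  nlinarith [mul_nonneg (sub_nonneg.2 hσ.le) hμD, mul_pos (sub_pos.2 hσ) hρ]

lemma gap_polynomial_le {x x₀ e : ℝ} (hx : 0 ≤ x) (hx₀ : x ≤ x₀)
    (h : (e = 0 ∧ x₀ = 3.1416 / 79) ∨ (e = 1 ∧ x₀ = 3.1416 / 43) ∨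
      (e = 2 ∧ x₀ = 3.1416 / 31)) :
    3 * (2 * 3.1416 + x) * (1.732051 / 2 + x / 3) ≤
      2 * (3.1415 - x) ^ 2 * ((1 - x ^ 2 / 6) * (1.73205 / 2 * (1 - ((1 / 6 + e) * x) ^ 2 / 2) +
        ((1 / 6 + e) * x - ((1 / 6 + e) * x) ^ 3 / 6) / 2)) := by
  have h2 : x ^ 2 ≤ x₀ * x := by nlinarith
  have h3 : x ^ 3 ≤ x₀ * x ^ 2 := by nlinarith [sq_nonneg x]
  have h4 : x ^ 4 ≤ x₀ * x ^ 3 := by nlinarith [pow_nonneg hx 3]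
  have h5 : x ^ 5 ≤ x₀ * x ^ 4 := by nlinarith [pow_nonneg hx 4]
  have h6 : x ^ 6 ≤ x₀ * x ^ 5 := by nlinarith [pow_nonneg hx 5]
  have h7 : x ^ 7 ≤ x₀ * x ^ 6 := by nlinarith [pow_nonneg hx 6]
  have := pow_nonneg hx 2
  have := pow_nonneg hx 3
  have := pow_nonneg hx 4
  have := pow_nonneg hx 5
  have := pow_nonneg hx 6
  have := pow_nonneg hx 7
  have := sq_nonneg (x - x₀)
  rcases h with ⟨rfl, rfl⟩ | ⟨rfl, rfl⟩ | ⟨rfl, rfl⟩ <;> linarith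

lemma sin_mul_le_of_gap {k q i e : ℕ} (hq : q = 6 * k + 1) (hi : i + e ≤ k)
    (he : (e = 0 ∧ 13 ≤ k) ∨ (e = 1 ∧ 7 ≤ k) ∨ (e = 2 ∧ 5 ≤ k)) :
    (4 * k + 1) * sin ((2 * k + 1) * (π / q)) ≤
      8 * k ^ 2 * sin (π / q) * cos (i * (π / q)) := by
  have hqr : (q : ℝ) = 6 * k + 1 := by rw [hq]; push_cast; ring
  have hq0 : (0 : ℝ) < q := by rw [hqr]; positivity
  obtain ⟨x, hxdef⟩ : ∃ x, x = π / q := ⟨_, rfl⟩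
  have hx : q * x = π := by rw [hxdef]; field_simp
  rw [← hxdef]
  have hpi : π = 6 * k * x + x := by rw [← hx, hqr]; ring
  have hx0 : 0 < x := by rw [hxdef]; exact div_pos pi_pos hq0
  have hir : (i : ℝ) + e ≤ k := by exact_mod_cast hi
  have hix : (i + e) * x ≤ k * x := by gcongr
  have hπl : 3.1415 < π := pi_gt_d4
  have hπu : π < 3.1416 := pi_lt_d4
  have he2 : (e : ℝ) ≤ 2 := by
    have : e ≤ 2 := by omega
    exact_mod_cast this
  have hk5 : (5 : ℝ) ≤ k := by
    have : 5 ≤ k := by omega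
    exact_mod_cast this
  have hkx : 5 * x ≤ k * x := by gcongr
  have hxle : x ≤ 3.1416 / 31 := by linarith
  obtain ⟨s, hs⟩ : ∃ s, s = (1 / 6 + (e : ℝ)) * x := ⟨_, rfl⟩
  have hs0 : 0 ≤ s := by rw [hs]; positivity
  have hs1 : s ≤ 1 / 4 := by
    rw [hs]
    calc (1 / 6 + (e : ℝ)) * x ≤ (1 / 6 + 2) * (3.1416 / 31) := by gcongr
      _ ≤ 1 / 4 := by norm_num
  have h3l : 1.73205 ≤ √3 := Real.le_sqrt_of_sq_le (by norm_num)
  have h3u : √3 ≤ 1.732051 := Real.sqrt_le_iff.2 ⟨by norm_num, by norm_num⟩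
  have hA : sin ((2 * k + 1) * x) ≤ 1.732051 / 2 + x / 3 := by
    have h1 : (2 * k + 1) * x = π / 3 + 2 * x / 3 := by linarith
    rw [h1, sin_add, sin_pi_div_three, cos_pi_div_three]
    have h2 : √3 / 2 * cos (2 * x / 3) ≤ 1.732051 / 2 := by
      calc √3 / 2 * cos (2 * x / 3) ≤ √3 / 2 * 1 := by gcongr; exact cos_le_one _
        _ ≤ 1.732051 / 2 := by linarith
    linarith [sin_le (show 0 ≤ 2 * x / 3 by positivity)]
  have hC : 1.73205 / 2 * (1 - s ^ 2 / 2) + (s - s ^ 3 / 6) / 2 ≤ cos (i * x) := by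
    have h1 : cos (π / 6 - s) ≤ cos (i * x) := by
      have : i * x ≤ π / 6 - s := by rw [hs]; linarith
      exact cos_le_cos_of_nonneg_of_le_pi (by positivity) (by linarith) this
    rw [cos_sub, cos_pi_div_six, sin_pi_div_six] at h1
    have h2 : 1.73205 / 2 * (1 - s ^ 2 / 2) ≤ √3 / 2 * cos s := by
      have : 0 ≤ 1 - s ^ 2 / 2 := by nlinarith
      gcongr
      exact cos_ge_quadratic s
    linarith [sin_ge_cubic hs0]
  have hC0 : 0 ≤ 1.73205 / 2 * (1 - s ^ 2 / 2) + (s - s ^ 3 / 6) / 2 := by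
    nlinarith [pow_nonneg hs0 2, pow_nonneg hs0 3]
  have hX0 : 0 ≤ 1 - x ^ 2 / 6 := by nlinarith
  have hS : x * (1 - x ^ 2 / 6) ≤ sin x := by linarith [sin_ge_cubic hx0.le]
  have hpoly : 3 * (2 * 3.1416 + x) * (1.732051 / 2 + x / 3) ≤
      2 * (3.1415 - x) ^ 2 *
        ((1 - x ^ 2 / 6) * (1.73205 / 2 * (1 - s ^ 2 / 2) + (s - s ^ 3 / 6) / 2)) := by
    rw [hs]
    rcases he with ⟨rfl, h⟩ | ⟨rfl, h⟩ | ⟨rfl, h⟩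
    · have : (13 : ℝ) * x ≤ k * x := by gcongr; exact_mod_cast h
      exact gap_polynomial_le hx0.le (by linarith) (Or.inl ⟨by norm_num, rfl⟩)
    · have : (7 : ℝ) * x ≤ k * x := by gcongr; exact_mod_cast h
      exact gap_polynomial_le hx0.le (by linarith) (Or.inr (Or.inl ⟨by norm_num, rfl⟩))
    · exact gap_polynomial_le hx0.le hxle (Or.inr (Or.inr ⟨by norm_num, rfl⟩))
  have hmain : 3 * (2 * π + x) * sin ((2 * k + 1) * x) * x ≤
      2 * (π - x) ^ 2 * (sin x * cos (i * x)) := by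
    calc 3 * (2 * π + x) * sin ((2 * k + 1) * x) * x
        ≤ 3 * (2 * 3.1416 + x) * (1.732051 / 2 + x / 3) * x := by
          gcongr
          exact sin_nonneg_of_nonneg_of_le_pi (by positivity) (by linarith)
      _ ≤ 2 * (3.1415 - x) ^ 2 *
          ((1 - x ^ 2 / 6) * (1.73205 / 2 * (1 - s ^ 2 / 2) + (s - s ^ 3 / 6) / 2)) * x := by
          gcongr
      _ = 2 * (3.1415 - x) ^ 2 * ((x * (1 - x ^ 2 / 6)) *
          (1.73205 / 2 * (1 - s ^ 2 / 2) + (s - s ^ 3 / 6) / 2)) := by ring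
      _ ≤ 2 * (π - x) ^ 2 * (sin x * cos (i * x)) := by
          have : (0 : ℝ) ≤ 3.1415 - x := by linarith
          gcongr
          exact le_trans (mul_nonneg hx0.le hX0) hS
  have h1 : 3 * (2 * π + x) * sin ((2 * k + 1) * x) * x
      = 9 * x ^ 2 * ((4 * k + 1) * sin ((2 * k + 1) * x)) := by
    nth_rewrite 1 [hpi]
    ring
  have h2 : 2 * (π - x) ^ 2 * (sin x * cos (i * x))
      = 9 * x ^ 2 * (8 * k ^ 2 * sin x * cos (i * x)) := by
    rw [show π - x = 6 * k * x by linarith]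
    ring
  rw [h1, h2] at hmain
  exact le_of_mul_le_mul_left hmain (by positivity)

/-! ### Integral dual certificates -/

lemma neg_zcos_add_half_nonpos {k q : ℕ} (hq : q = 6 * k + 1) {j : ZMod q}
    (hj : j.val ≤ k ∨ 5 * k < j.val) : -zcos q j + 1 / 2 ≤ 0 := by
  have hqr : (q : ℝ) = 6 * k + 1 := by rw [hq]; push_cast; ring
  have hq0 : (0 : ℝ) < q := by rw [hqr]; positivity
  have : NeZero q := ⟨by omega⟩
  have hlt := j.val_lt
  have hπ := pi_pos
  suffices 1 / 2 ≤ zcos q j by linarith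
  rw [zcos, ← cos_pi_div_three]
  rcases hj with h | h
  · have h' : (j.val : ℝ) ≤ k := by exact_mod_cast h
    refine cos_le_cos_of_nonneg_of_le_pi (by positivity) (by linarith) ?_
    rw [div_le_div_iff₀ hq0 (by norm_num), hqr]
    nlinarith
  · have h' : 5 * (k : ℝ) + 1 ≤ j.val := by exact_mod_cast h
    have h2 : (j.val : ℝ) ≤ q := by exact_mod_cast hlt.le
    rw [← cos_two_pi_sub (2 * π * j.val / q)]
    have h3 : 2 * π - 2 * π * j.val / q = 2 * π * (q - j.val) / q := by field_simp
    rw [h3]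
    refine cos_le_cos_of_nonneg_of_le_pi ?_ (by linarith) ?_
    · have : 0 ≤ (q : ℝ) - j.val := by linarith
      positivity
    · rw [div_le_div_iff₀ hq0 (by norm_num), hqr]
      nlinarith

lemma neg_zcos_add_half_le {k q : ℕ} (hq : q = 6 * k + 1) {j : ZMod q}
    (hj : k < j.val ∧ j.val ≤ 5 * k) {Y : ℝ}
    (hY : Y * q ^ 2 = 9.869 * ((q : ℝ) - 2 * j.val) ^ 2) :
    -zcos q j + 1 / 2 ≤ 3 / 2 - Y / 2 + Y ^ 2 / 24 := by
  have hqr : (q : ℝ) = 6 * k + 1 := by rw [hq]; push_cast; ring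
  have hq0 : (0 : ℝ) < q := by rw [hqr]; positivity
  have h1 : (k : ℝ) + 1 ≤ j.val := by exact_mod_cast hj.1
  have h2 : (j.val : ℝ) ≤ 5 * k := by exact_mod_cast hj.2
  obtain ⟨t, ht⟩ : ∃ t, t = |(q : ℝ) - 2 * j.val| / q := ⟨_, rfl⟩
  have ht0 : 0 ≤ t := by rw [ht]; positivity
  have ht1 : t ≤ 2 / 3 := by
    rw [ht, div_le_iff₀ hq0, abs_le]
    constructor <;> linarith
  have hYt : Y = 9.869 * t ^ 2 := by
    rw [ht, div_pow, sq_abs]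
    field_simp
    linarith
  have hcos : -zcos q j = cos (π * t) := by
    have h3 : π * t = |π - 2 * π * j.val / q| := by
      rw [ht, show π - 2 * π * j.val / q = π * (((q : ℝ) - 2 * j.val) / q) by field_simp,
        abs_mul, abs_div, abs_of_pos pi_pos, abs_of_pos hq0]
    rw [h3, cos_abs, cos_pi_sub, zcos]
  have hπl : 3.1415 < π := pi_gt_d4
  have hπu : π < 3.1416 := pi_lt_d4
  have hz := cos_le_quartic (mul_nonneg pi_pos.le ht0)
  have hY0 : 0 ≤ Y := by rw [hYt]; positivity
  have hYz : Y ≤ (π * t) ^ 2 := by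
    rw [hYt, mul_pow]
    gcongr
    nlinarith
  have hz6 : (π * t) ^ 2 ≤ 6 := by
    have : π * t ≤ 3.1416 * (2 / 3) := by gcongr
    nlinarith [mul_nonneg pi_pos.le ht0]
  rw [hcos]
  obtain ⟨z, hz'⟩ : ∃ z, z = (π * t) ^ 2 := ⟨_, rfl⟩
  rw [show (π * t) ^ 4 = ((π * t) ^ 2) ^ 2 by ring, ← hz'] at hz
  rw [← hz'] at hYz hz6
  nlinarith

/-- A profile of mass exceeding `2k` vanishes at `i` if there is a suitable dual solution of the
linear program given by the shift constraints for `i` and the doubling constraints. -/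
lemma IsSumFreeProfile.eq_zero_of_certificate {q : ℕ} [NeZero q] {α : ZMod q → ℝ}
    (h : IsSumFreeProfile q α) {k : ℕ} (hq : q = 6 * k + 1)
    (hσ : 2 * (k : ℝ) < ∑ j, α j) {i : ℕ} (N : ℕ) (U D : List ℕ)
    (hcheck : 0 < N ∧ i ≤ q ∧ (∀ n < q, k < 2 * n % q → 2 * n % q ≤ 5 * k →
        N * (36 * (1000 * q ^ 2 : ℤ) ^ 2
            - 12 * (9869 * ((q : ℤ) - 2 * (2 * n % q : ℕ)) ^ 2) * (1000 * q ^ 2)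
            + (9869 * ((q : ℤ) - 2 * (2 * n % q : ℕ)) ^ 2) ^ 2)
          ≤ 24 * (1000 * q ^ 2 : ℤ) ^ 2 *
            (U.getD (2 * n % q) 0 + U.getD ((2 * n + (q - i)) % q) 0
              + D.getD (2 * n % q) 0 + D.getD n 0 : ℕ)) ∧
      (4 * k + 1) * (∑ n ∈ Finset.range q, U.getD n 0 + ∑ n ∈ Finset.range q, D.getD n 0)
        ≤ N * (k * (8 * k + 1))) : α i = 0 := by
  obtain ⟨hN, hiq, hcover, htot⟩ := hcheck
  by_contra hα
  have hqr : (q : ℝ) = 6 * k + 1 := by rw [hq]; push_cast; ring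
  have hq0 : (0 : ℝ) < q := by rw [hqr]; positivity
  have hNr : (0 : ℝ) < N := by exact_mod_cast hN
  have hsum : ∀ f : ℕ → ℝ, ∑ j : ZMod q, f j.val = ∑ n ∈ Finset.range q, f n := by
    intro f
    subst hq
    rw [Finset.sum_range]
    rfl
  have key := sum_mul_le_of_cover (q := q) (α := α) (w := fun j => -zcos q j + 1 / 2)
    (u := fun j => (U.getD j.val 0 : ℝ) / N) (d := fun j => (D.getD j.val 0 : ℝ) / N)
    ⟨3 * k, by omega⟩ i h.nonneg (fun j => by positivity) (fun j => by positivity)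
    (fun j _ => h.pair _ _ hα) h.add_double_le (fun j _ => by
      have hv : (2 * j).val = 2 * j.val % q := by rw [two_mul, ZMod.val_add, two_mul]
      have hvi : (2 * j - i).val = (2 * j.val + (q - i)) % q := by
        have : 2 * j - i = ((2 * j.val + (q - i) : ℕ) : ZMod q) := by
          push_cast [hiq]
          simp [sub_eq_add_neg]
        rw [this, ZMod.val_natCast]
      by_cases hm : k < (2 * j).val ∧ (2 * j).val ≤ 5 * k
      · have hc := hcover j.val j.val_lt (by rw [← hv]; exact hm.1) (by rw [← hv]; exact hm.2)
        rw [← hv, ← hvi] at hc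
        have hc' : (N : ℝ) * (36 * (1000 * q ^ 2) ^ 2
            - 12 * (9869 * ((q : ℝ) - 2 * (2 * j).val) ^ 2) * (1000 * q ^ 2)
            + (9869 * ((q : ℝ) - 2 * (2 * j).val) ^ 2) ^ 2)
          ≤ 24 * (1000 * q ^ 2) ^ 2 * (U.getD (2 * j).val 0 + U.getD (2 * j - i).val 0
              + D.getD (2 * j).val 0 + D.getD j.val 0) := by exact_mod_cast hc
        obtain ⟨Y, hY⟩ : ∃ Y, Y = 9.869 * ((q : ℝ) - 2 * (2 * j).val) ^ 2 / q ^ 2 := ⟨_, rfl⟩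
        have hY' : Y * q ^ 2 = 9.869 * ((q : ℝ) - 2 * (2 * j).val) ^ 2 := by
          rw [hY]; field_simp
        have hle := neg_zcos_add_half_le hq hm hY'
        refine hle.trans ?_
        rw [← add_div, ← add_div, ← add_div, le_div_iff₀ hNr]
        have h9 : 9869 * ((q : ℝ) - 2 * (2 * j).val) ^ 2 = 1000 * (Y * q ^ 2) := by
          rw [hY']; ring
        rw [h9] at hc'
        have hpos : (0 : ℝ) < 24 * (1000 * q ^ 2) ^ 2 := by positivity
        refine le_of_mul_le_mul_left (le_trans (le_of_eq ?_) hc') hpos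
        ring
      · refine (neg_zcos_add_half_nonpos hq (by omega)).trans (by positivity))
  have hmass := h.mass_le hq hσ
  rw [hsum (fun n => (U.getD n 0 : ℝ) / N), hsum (fun n => (D.getD n 0 : ℝ) / N),
    ← Finset.sum_div, ← Finset.sum_div, ← add_div, le_div_iff₀ hNr] at key
  have htot' : (4 * (k : ℝ) + 1) * (∑ n ∈ Finset.range q, (U.getD n 0 : ℝ)
      + ∑ n ∈ Finset.range q, (D.getD n 0 : ℝ)) ≤ N * (k * (8 * k + 1)) := by
    exact_mod_cast htot
  simp only [mul_add, mul_neg, Finset.sum_add_distrib, Finset.sum_neg_distrib,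
    ← Finset.sum_mul] at key
  set σ := ∑ j, α j
  set F := ∑ j, α j * zcos q j
  have h1 : (4 * (k : ℝ) + 1) * ((-F + σ * (1 / 2)) * N) ≤ N * (k * (8 * k + 1)) :=
    (mul_le_mul_of_nonneg_left key (by positivity)).trans (by linarith)
  have h2 : (4 * (k : ℝ) + 1) * (-F + σ * (1 / 2)) ≤ k * (8 * k + 1) := by
    refine le_of_mul_le_mul_left (le_trans (le_of_eq ?_) h1) hNr
    ring
  nlinarith [mul_nonneg (Nat.cast_nonneg (α := ℝ) k) (sub_nonneg.2 hσ.le)]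

lemma IsSumFreeProfile.eq_zero_31_4 {α : ZMod 31 → ℝ} (h : IsSumFreeProfile 31 α)
    (hσ : 2 * ((5 : ℕ) : ℝ) < ∑ j, α j) : α (4 : ℕ) = 0 :=
  h.eq_zero_of_certificate (k := 5) rfl hσ 40
    [0, 0, 0, 0, 0, 0, 9, 11, 23, 31, 29, 34, 28, 25, 25, 26, 32, 31, 31, 23, 13, 7]
    [0, 0, 0, 0, 0, 0, 0, 5, 0, 0, 0, 0, 0, 0, 0, 0, 0, 0, 0, 0, 0, 0, 0, 0, 3, 2]
    (by decide +kernel)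

lemma IsSumFreeProfile.eq_zero_31_5 {α : ZMod 31 → ℝ} (h : IsSumFreeProfile 31 α)
    (hσ : 2 * ((5 : ℕ) : ℝ) < ∑ j, α j) : α (5 : ℕ) = 0 :=
  h.eq_zero_of_certificate (k := 5) rfl hσ 40
    [0, 0, 0, 0, 0, 0, 9, 16, 23, 23, 34, 25, 35, 32, 36, 26, 35, 24, 23, 16, 9]
    [0, 0, 0, 0, 0, 0, 0, 0, 0, 0, 4, 7, 0, 0, 0, 0, 0, 0, 0, 0, 8, 4]
    (by decide +kernel)

lemma IsSumFreeProfile.eq_zero_37_5 {α : ZMod 37 → ℝ} (h : IsSumFreeProfile 37 α)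
    (hσ : 2 * ((6 : ℕ) : ℝ) < ∑ j, α j) : α (5 : ℕ) = 0 :=
  h.eq_zero_of_certificate (k := 6) rfl hσ 20
    [0, 0, 0, 0, 0, 0, 0, 4, 7, 10, 13, 16, 16, 15, 14, 14, 13, 14, 15, 16, 16, 16, 13, 10, 7, 4]
    [0, 0, 0, 0, 0, 0, 0, 1]
    (by decide +kernel)

lemma IsSumFreeProfile.eq_zero_37_6 {α : ZMod 37 → ℝ} (h : IsSumFreeProfile 37 α)
    (hσ : 2 * ((6 : ℕ) : ℝ) < ∑ j, α j) : α (6 : ℕ) = 0 :=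
  h.eq_zero_of_certificate (k := 6) rfl hσ 20
    [0, 0, 0, 0, 0, 0, 0, 4, 7, 10, 13, 12, 17, 13, 18, 16, 16, 18, 13, 17, 12, 13, 10, 7, 4]
    [0, 0, 0, 0, 0, 0, 0, 0, 0, 0, 0, 1, 3, 2, 0, 0, 0, 0, 0, 0, 0, 0, 0, 0, 3, 3, 2]
    (by decide +kernel)

lemma IsSumFreeProfile.eq_zero_43_7 {α : ZMod 43 → ℝ} (h : IsSumFreeProfile 43 α)
    (hσ : 2 * ((7 : ℕ) : ℝ) < ∑ j, α j) : α (7 : ℕ) = 0 :=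
  h.eq_zero_of_certificate (k := 7) rfl hσ 16
    [0, 0, 0, 0, 0, 0, 0, 0, 3, 5, 7, 9, 12, 9, 14, 11, 15, 11, 13, 11, 15, 11, 14, 9, 12, 9, 7,
     5, 3]
    [0, 0, 0, 0, 0, 0, 0, 0, 0, 0, 0, 0, 0, 3, 2, 2, 0, 0, 0, 0, 0, 0, 0, 0, 0, 0, 0, 0, 2, 2, 3]
    (by decide +kernel)

lemma IsSumFreeProfile.eq_zero_49_8 {α : ZMod 49 → ℝ} (h : IsSumFreeProfile 49 α)
    (hσ : 2 * ((8 : ℕ) : ℝ) < ∑ j, α j) : α (8 : ℕ) = 0 :=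
  h.eq_zero_of_certificate (k := 8) rfl hσ 16
    [0, 0, 0, 0, 0, 0, 0, 0, 0, 3, 5, 7, 8, 9, 12, 10, 13, 11, 13, 12, 14, 14, 12, 14, 11, 13,
     11, 12, 9, 8, 7, 5, 3]
    [0, 0, 0, 0, 0, 0, 0, 0, 0, 0, 0, 0, 0, 0, 0, 3, 3, 1, 1, 0, 0, 0, 0, 0, 0, 0, 0, 0, 0, 0, 0,
     1, 1, 3, 2]
    (by decide +kernel)

lemma IsSumFreeProfile.eq_zero_61_10 {α : ZMod 61 → ℝ} (h : IsSumFreeProfile 61 α)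
    (hσ : 2 * ((10 : ℕ) : ℝ) < ∑ j, α j) : α (10 : ℕ) = 0 :=
  h.eq_zero_of_certificate (k := 10) rfl hσ 12
    [0, 0, 0, 0, 0, 0, 0, 0, 0, 0, 0, 2, 3, 4, 5, 6, 8, 7, 9, 9, 9, 8, 9, 9, 11, 10, 10, 11, 9,
     9, 9, 10, 9, 9, 7, 8, 6, 5, 4, 3, 2]
    [0, 0, 0, 0, 0, 0, 0, 0, 0, 0, 0, 0, 0, 0, 0, 0, 0, 0, 1, 2, 3, 0, 2, 0, 0, 0, 0, 0, 0, 0, 0,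
     0, 0, 0, 0, 0, 0, 0, 0, 2, 0, 3, 2, 1]
    (by decide +kernel)

lemma IsSumFreeProfile.eq_zero_67_11 {α : ZMod 67 → ℝ} (h : IsSumFreeProfile 67 α)
    (hσ : 2 * ((11 : ℕ) : ℝ) < ∑ j, α j) : α (11 : ℕ) = 0 :=
  h.eq_zero_of_certificate (k := 11) rfl hσ 12
    [0, 0, 0, 0, 0, 0, 0, 0, 0, 0, 0, 0, 2, 3, 4, 5, 6, 7, 8, 7, 9, 9, 9, 8, 9, 9, 11, 8, 10, 9,
     11, 9, 9, 9, 10, 9, 9, 7, 8, 7, 6, 5, 4, 3, 2]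
    [0, 0, 0, 0, 0, 0, 0, 0, 0, 0, 0, 0, 0, 0, 0, 0, 0, 0, 0, 1, 1, 2, 3, 0, 2, 0, 0, 0, 0, 0, 0,
     0, 0, 0, 0, 0, 0, 0, 0, 0, 0, 0, 0, 2, 0, 3, 2, 2]
    (by decide +kernel)

lemma IsSumFreeProfile.eq_zero_73_12 {α : ZMod 73 → ℝ} (h : IsSumFreeProfile 73 α)
    (hσ : 2 * ((12 : ℕ) : ℝ) < ∑ j, α j) : α (12 : ℕ) = 0 :=
  h.eq_zero_of_certificate (k := 12) rfl hσ 16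
    [0, 0, 0, 0, 0, 0, 0, 0, 0, 0, 0, 0, 0, 3, 4, 5, 6, 7, 9, 9, 11, 9, 12, 12, 13, 11, 11, 12,
     15, 12, 14, 14, 12, 15, 12, 12, 11, 13, 13, 12, 9, 11, 9, 9, 7, 6, 5, 4, 3]
    [0, 0, 0, 0, 0, 0, 0, 0, 0, 0, 0, 0, 0, 0, 0, 0, 0, 0, 0, 0, 0, 0, 2, 2, 3, 0, 3, 1, 0, 0, 0,
     0, 0, 0, 0, 0, 0, 0, 0, 0, 0, 0, 0, 0, 0, 0, 1, 3, 1, 3, 2, 2]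
    (by decide +kernel)

/-! ### Moduli seven, thirteen and nineteen -/

lemma le_zcos_of_le {q : ℕ} [NeZero q] {j : ZMod q} (n : ℕ) (hj : j.val = n) {r : ℝ} (t : ℝ)
    (ht : 0 ≤ t)
    (hn : t * q = 2 * n ∨ t * q = 2 * (q - n))
    (hr : r ≤ 1 - (3.1416 * t) ^ 2 / 2 + (3.1415 * t) ^ 4 / 24 - (3.1416 * t) ^ 6 / 720) :
    r ≤ zcos q j := by
  have hq : (q : ℝ) ≠ 0 := Nat.cast_ne_zero.2 (NeZero.ne q)
  have hπl : 3.1415 < π := pi_gt_d4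
  have hπu : π < 3.1416 := pi_lt_d4
  have hcos : zcos q j = cos (π * t) := by
    rw [zcos, hj]
    rcases hn with hn | hn
    · congr 1
      field_simp
      linarith
    · rw [← cos_two_pi_sub]
      congr 1
      field_simp
      linarith
  have h2 : (π * t) ^ 2 ≤ (3.1416 * t) ^ 2 := by gcongr
  have h4 : (3.1415 * t) ^ 4 ≤ (π * t) ^ 4 := by gcongr
  have h6 : (π * t) ^ 6 ≤ (3.1416 * t) ^ 6 := by gcongr
  rw [hcos]
  linarith [cos_ge_sextic (mul_nonneg pi_pos.le ht)]

lemma le_zcos_of_le_neg {q : ℕ} [NeZero q] {j : ZMod q} (n : ℕ) (hj : j.val = n) {r : ℝ}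
    (t : ℝ) (ht : 0 ≤ t)
    (hn : t * q = q - 2 * n ∨ t * q = 2 * n - q)
    (hr : r ≤ -(1 - (3.1415 * t) ^ 2 / 2 + (3.1416 * t) ^ 4 / 24 - (3.1415 * t) ^ 6 / 720
      + (3.1416 * t) ^ 8 / 40320)) :
    r ≤ zcos q j := by
  have hq : (q : ℝ) ≠ 0 := Nat.cast_ne_zero.2 (NeZero.ne q)
  have hπl : 3.1415 < π := pi_gt_d4
  have hπu : π < 3.1416 := pi_lt_d4
  have hcos : zcos q j = -cos (π * t) := by
    rw [zcos, hj]
    rcases hn with hn | hn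
    · rw [← cos_pi_sub]
      congr 1
      field_simp
      linarith
    · have : π * t = 2 * π * n / q - π := by
        field_simp
        linarith
      rw [this, cos_sub_pi, neg_neg]
  have h2 : (3.1415 * t) ^ 2 ≤ (π * t) ^ 2 := by gcongr
  have h4 : (π * t) ^ 4 ≤ (3.1416 * t) ^ 4 := by gcongr
  have h6 : (3.1415 * t) ^ 6 ≤ (π * t) ^ 6 := by gcongr
  have h8 : (π * t) ^ 8 ≤ (3.1416 * t) ^ 8 := by gcongr
  rw [hcos]
  linarith [cos_le_octic (mul_nonneg pi_pos.le ht)]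

lemma sum_zmod_eq_sum_range {q : ℕ} [NeZero q] (f : ZMod q → ℝ) :
    ∑ j, f j = ∑ n ∈ Finset.range q, f n := by
  rw [Finset.sum_range]
  obtain ⟨m, rfl⟩ : ∃ m, q = m + 1 := ⟨q - 1, by have := NeZero.pos q; omega⟩
  refine Finset.sum_congr rfl fun j _ => ?_
  congr 1
  exact (Fin.cast_val_eq_self j).symm

namespace IsSumFreeProfile

variable {q : ℕ} [NeZero q] {α : ZMod q → ℝ}

lemma pair_of_eq (h : IsSumFreeProfile q α) {s : ZMod q} (j t : ZMod q) (hs : α s ≠ 0)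
    (ht : j + s = t) : α j + α t ≤ 1 :=
  ht ▸ h.pair s j hs

lemma double_of_eq (h : IsSumFreeProfile q α) (j t : ZMod q) (ht : 2 * j = t) :
    α j + α t ≤ 1 :=
  ht ▸ h.add_double_le j

lemma triple_of_eq (h : IsSumFreeProfile q α) {a b : ZMod q} (c : ZMod q) (ha : α a ≠ 0)
    (hb : α b ≠ 0) (hc : α c ≠ 0) (hab : a + b = c) : α a + α b + α c ≤ 8 / 7 := by
  subst hab
  exact h.triple a b ha hb hc

lemma double_triple_of_eq (h : IsSumFreeProfile q α) (a c : ZMod q) (hac : a + a = c) :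
    α a = 0 ∨ α c = 0 ∨ 2 * α a + α c ≤ 8 / 7 := by
  by_cases ha : α a = 0
  · exact Or.inl ha
  by_cases hc : α c = 0
  · exact Or.inr (Or.inl hc)
  · right; right
    linarith [h.triple_of_eq c ha ha hc hac]

end IsSumFreeProfile

lemma IsSumFreeProfile.mass_7 {α : ZMod 7 → ℝ} (h : IsSumFreeProfile 7 α)
    (hσ : 2 * ((1 : ℕ) : ℝ) < ∑ j, α j) :
    2 <
      α 0 + α 1 + α 2 + α 3 + α 4 + α 5 + α 6 ∧
      α 0 * (14000 / 10000) + α 1 * (10234 / 10000) + α 2 * (1774 / 10000) + α 3 * (-5010 / 10000)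
      + α 4 * (-5010 / 10000) + α 5 * (1774 / 10000) + α 6 * (10234 / 10000)
      ≤ 0 := by
  have hm := h.mass_le rfl hσ
  rw [sum_zmod_eq_sum_range] at hσ hm
  rw [sum_zmod_eq_sum_range] at hm
  simp only [Finset.sum_range_succ, Finset.sum_range_zero, zero_add] at hσ hm
  norm_num only [Nat.cast_ofNat, Nat.cast_zero, Nat.cast_one] at hσ hm ⊢
  have h0 : α 0 * (10000 / 10000) ≤ α 0 * zcos 7 0 :=
    mul_le_mul_of_nonneg_left (le_zcos_of_le 0 rfl (0 / 1) (by norm_num)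
      (by norm_num) (by norm_num)) (h.nonneg _)
  have h1 : α 1 * (6234 / 10000) ≤ α 1 * zcos 7 1 :=
    mul_le_mul_of_nonneg_left (le_zcos_of_le 1 rfl (2 / 7) (by norm_num)
      (by norm_num) (by norm_num)) (h.nonneg _)
  have h2 : α 2 * (-2226 / 10000) ≤ α 2 * zcos 7 2 :=
    mul_le_mul_of_nonneg_left (le_zcos_of_le_neg 2 rfl (3 / 7) (by norm_num)
      (by norm_num) (by norm_num)) (h.nonneg _)
  have h3 : α 3 * (-9010 / 10000) ≤ α 3 * zcos 7 3 :=
    mul_le_mul_of_nonneg_left (le_zcos_of_le_neg 3 rfl (1 / 7) (by norm_num)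
      (by norm_num) (by norm_num)) (h.nonneg _)
  have h4 : α 4 * (-9010 / 10000) ≤ α 4 * zcos 7 4 :=
    mul_le_mul_of_nonneg_left (le_zcos_of_le_neg 4 rfl (1 / 7) (by norm_num)
      (by norm_num) (by norm_num)) (h.nonneg _)
  have h5 : α 5 * (-2226 / 10000) ≤ α 5 * zcos 7 5 :=
    mul_le_mul_of_nonneg_left (le_zcos_of_le_neg 5 rfl (3 / 7) (by norm_num)
      (by norm_num) (by norm_num)) (h.nonneg _)
  have h6 : α 6 * (6234 / 10000) ≤ α 6 * zcos 7 6 :=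
    mul_le_mul_of_nonneg_left (le_zcos_of_le 6 rfl (2 / 7) (by norm_num)
      (by norm_num) (by norm_num)) (h.nonneg _)
  exact ⟨by linarith, by linarith⟩

lemma IsSumFreeProfile.mass_13 {α : ZMod 13 → ℝ} (h : IsSumFreeProfile 13 α)
    (hσ : 2 * ((2 : ℕ) : ℝ) < ∑ j, α j) :
    4 <
      α 0 + α 1 + α 2 + α 3 + α 4 + α 5 + α 6 + α 7 + α 8 + α 9 + α 10 + α 11 + α 12 ∧
      α 0 * (14444 / 10000) + α 1 * (13298 / 10000) + α 2 * (10124 / 10000) + α 3 * (5644 / 10000)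
      + α 4 * (897 / 10000) + α 5 * (-3042 / 10000) + α 6 * (-5266 / 10000)
      + α 7 * (-5266 / 10000) + α 8 * (-3042 / 10000) + α 9 * (897 / 10000)
      + α 10 * (5644 / 10000) + α 11 * (10124 / 10000) + α 12 * (13298 / 10000)
      ≤ 0 := by
  have hm := h.mass_le rfl hσ
  rw [sum_zmod_eq_sum_range] at hσ hm
  rw [sum_zmod_eq_sum_range] at hm
  simp only [Finset.sum_range_succ, Finset.sum_range_zero, zero_add] at hσ hm
  norm_num only [Nat.cast_ofNat, Nat.cast_zero, Nat.cast_one] at hσ hm ⊢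
  have h0 : α 0 * (10000 / 10000) ≤ α 0 * zcos 13 0 :=
    mul_le_mul_of_nonneg_left (le_zcos_of_le 0 rfl (0 / 1) (by norm_num)
      (by norm_num) (by norm_num)) (h.nonneg _)
  have h1 : α 1 * (8854 / 10000) ≤ α 1 * zcos 13 1 :=
    mul_le_mul_of_nonneg_left (le_zcos_of_le 1 rfl (2 / 13) (by norm_num)
      (by norm_num) (by norm_num)) (h.nonneg _)
  have h2 : α 2 * (5680 / 10000) ≤ α 2 * zcos 13 2 :=
    mul_le_mul_of_nonneg_left (le_zcos_of_le 2 rfl (4 / 13) (by norm_num)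
      (by norm_num) (by norm_num)) (h.nonneg _)
  have h3 : α 3 * (1200 / 10000) ≤ α 3 * zcos 13 3 :=
    mul_le_mul_of_nonneg_left (le_zcos_of_le 3 rfl (6 / 13) (by norm_num)
      (by norm_num) (by norm_num)) (h.nonneg _)
  have h4 : α 4 * (-3547 / 10000) ≤ α 4 * zcos 13 4 :=
    mul_le_mul_of_nonneg_left (le_zcos_of_le_neg 4 rfl (5 / 13) (by norm_num)
      (by norm_num) (by norm_num)) (h.nonneg _)
  have h5 : α 5 * (-7486 / 10000) ≤ α 5 * zcos 13 5 :=
    mul_le_mul_of_nonneg_left (le_zcos_of_le_neg 5 rfl (3 / 13) (by norm_num)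
      (by norm_num) (by norm_num)) (h.nonneg _)
  have h6 : α 6 * (-9710 / 10000) ≤ α 6 * zcos 13 6 :=
    mul_le_mul_of_nonneg_left (le_zcos_of_le_neg 6 rfl (1 / 13) (by norm_num)
      (by norm_num) (by norm_num)) (h.nonneg _)
  have h7 : α 7 * (-9710 / 10000) ≤ α 7 * zcos 13 7 :=
    mul_le_mul_of_nonneg_left (le_zcos_of_le_neg 7 rfl (1 / 13) (by norm_num)
      (by norm_num) (by norm_num)) (h.nonneg _)
  have h8 : α 8 * (-7486 / 10000) ≤ α 8 * zcos 13 8 :=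
    mul_le_mul_of_nonneg_left (le_zcos_of_le_neg 8 rfl (3 / 13) (by norm_num)
      (by norm_num) (by norm_num)) (h.nonneg _)
  have h9 : α 9 * (-3547 / 10000) ≤ α 9 * zcos 13 9 :=
    mul_le_mul_of_nonneg_left (le_zcos_of_le_neg 9 rfl (5 / 13) (by norm_num)
      (by norm_num) (by norm_num)) (h.nonneg _)
  have h10 : α 10 * (1200 / 10000) ≤ α 10 * zcos 13 10 :=
    mul_le_mul_of_nonneg_left (le_zcos_of_le 10 rfl (6 / 13) (by norm_num)
      (by norm_num) (by norm_num)) (h.nonneg _)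
  have h11 : α 11 * (5680 / 10000) ≤ α 11 * zcos 13 11 :=
    mul_le_mul_of_nonneg_left (le_zcos_of_le 11 rfl (4 / 13) (by norm_num)
      (by norm_num) (by norm_num)) (h.nonneg _)
  have h12 : α 12 * (8854 / 10000) ≤ α 12 * zcos 13 12 :=
    mul_le_mul_of_nonneg_left (le_zcos_of_le 12 rfl (2 / 13) (by norm_num)
      (by norm_num) (by norm_num)) (h.nonneg _)
  exact ⟨by linarith, by linarith⟩

lemma IsSumFreeProfile.mass_19 {α : ZMod 19 → ℝ} (h : IsSumFreeProfile 19 α)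
    (hσ : 2 * ((3 : ℕ) : ℝ) < ∑ j, α j) :
    6 <
      α 0 + α 1 + α 2 + α 3 + α 4 + α 5 + α 6 + α 7 + α 8 + α 9 + α 10 + α 11 + α 12 + α 13 + α 14
      + α 15 + α 16 + α 17 + α 18 ∧
      α 0 * (14615 / 10000) + α 1 * (14073 / 10000) + α 2 * (12506 / 10000)
      + α 3 * (10084 / 10000) + α 4 * (7067 / 10000) + α 5 * (3788 / 10000) + α 6 * (597 / 10000)
      + α 7 * (-2159 / 10000) + α 8 * (-4180 / 10000) + α 9 * (-5249 / 10000)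
      + α 10 * (-5249 / 10000) + α 11 * (-4180 / 10000) + α 12 * (-2159 / 10000)
      + α 13 * (597 / 10000) + α 14 * (3788 / 10000) + α 15 * (7067 / 10000)
      + α 16 * (10084 / 10000) + α 17 * (12506 / 10000) + α 18 * (14073 / 10000)
      ≤ 0 := by
  have hm := h.mass_le rfl hσ
  rw [sum_zmod_eq_sum_range] at hσ hm
  rw [sum_zmod_eq_sum_range] at hm
  simp only [Finset.sum_range_succ, Finset.sum_range_zero, zero_add] at hσ hm
  norm_num only [Nat.cast_ofNat, Nat.cast_zero, Nat.cast_one] at hσ hm ⊢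
  have h0 : α 0 * (10000 / 10000) ≤ α 0 * zcos 19 0 :=
    mul_le_mul_of_nonneg_left (le_zcos_of_le 0 rfl (0 / 1) (by norm_num)
      (by norm_num) (by norm_num)) (h.nonneg _)
  have h1 : α 1 * (9458 / 10000) ≤ α 1 * zcos 19 1 :=
    mul_le_mul_of_nonneg_left (le_zcos_of_le 1 rfl (2 / 19) (by norm_num)
      (by norm_num) (by norm_num)) (h.nonneg _)
  have h2 : α 2 * (7891 / 10000) ≤ α 2 * zcos 19 2 :=
    mul_le_mul_of_nonneg_left (le_zcos_of_le 2 rfl (4 / 19) (by norm_num)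
      (by norm_num) (by norm_num)) (h.nonneg _)
  have h3 : α 3 * (5469 / 10000) ≤ α 3 * zcos 19 3 :=
    mul_le_mul_of_nonneg_left (le_zcos_of_le 3 rfl (6 / 19) (by norm_num)
      (by norm_num) (by norm_num)) (h.nonneg _)
  have h4 : α 4 * (2452 / 10000) ≤ α 4 * zcos 19 4 :=
    mul_le_mul_of_nonneg_left (le_zcos_of_le 4 rfl (8 / 19) (by norm_num)
      (by norm_num) (by norm_num)) (h.nonneg _)
  have h5 : α 5 * (-827 / 10000) ≤ α 5 * zcos 19 5 :=
    mul_le_mul_of_nonneg_left (le_zcos_of_le_neg 5 rfl (9 / 19) (by norm_num)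
      (by norm_num) (by norm_num)) (h.nonneg _)
  have h6 : α 6 * (-4018 / 10000) ≤ α 6 * zcos 19 6 :=
    mul_le_mul_of_nonneg_left (le_zcos_of_le_neg 6 rfl (7 / 19) (by norm_num)
      (by norm_num) (by norm_num)) (h.nonneg _)
  have h7 : α 7 * (-6774 / 10000) ≤ α 7 * zcos 19 7 :=
    mul_le_mul_of_nonneg_left (le_zcos_of_le_neg 7 rfl (5 / 19) (by norm_num)
      (by norm_num) (by norm_num)) (h.nonneg _)
  have h8 : α 8 * (-8795 / 10000) ≤ α 8 * zcos 19 8 :=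
    mul_le_mul_of_nonneg_left (le_zcos_of_le_neg 8 rfl (3 / 19) (by norm_num)
      (by norm_num) (by norm_num)) (h.nonneg _)
  have h9 : α 9 * (-9864 / 10000) ≤ α 9 * zcos 19 9 :=
    mul_le_mul_of_nonneg_left (le_zcos_of_le_neg 9 rfl (1 / 19) (by norm_num)
      (by norm_num) (by norm_num)) (h.nonneg _)
  have h10 : α 10 * (-9864 / 10000) ≤ α 10 * zcos 19 10 :=
    mul_le_mul_of_nonneg_left (le_zcos_of_le_neg 10 rfl (1 / 19) (by norm_num)
      (by norm_num) (by norm_num)) (h.nonneg _)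
  have h11 : α 11 * (-8795 / 10000) ≤ α 11 * zcos 19 11 :=
    mul_le_mul_of_nonneg_left (le_zcos_of_le_neg 11 rfl (3 / 19) (by norm_num)
      (by norm_num) (by norm_num)) (h.nonneg _)
  have h12 : α 12 * (-6774 / 10000) ≤ α 12 * zcos 19 12 :=
    mul_le_mul_of_nonneg_left (le_zcos_of_le_neg 12 rfl (5 / 19) (by norm_num)
      (by norm_num) (by norm_num)) (h.nonneg _)
  have h13 : α 13 * (-4018 / 10000) ≤ α 13 * zcos 19 13 :=
    mul_le_mul_of_nonneg_left (le_zcos_of_le_neg 13 rfl (7 / 19) (by norm_num)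
      (by norm_num) (by norm_num)) (h.nonneg _)
  have h14 : α 14 * (-827 / 10000) ≤ α 14 * zcos 19 14 :=
    mul_le_mul_of_nonneg_left (le_zcos_of_le_neg 14 rfl (9 / 19) (by norm_num)
      (by norm_num) (by norm_num)) (h.nonneg _)
  have h15 : α 15 * (2452 / 10000) ≤ α 15 * zcos 19 15 :=
    mul_le_mul_of_nonneg_left (le_zcos_of_le 15 rfl (8 / 19) (by norm_num)
      (by norm_num) (by norm_num)) (h.nonneg _)
  have h16 : α 16 * (5469 / 10000) ≤ α 16 * zcos 19 16 :=
    mul_le_mul_of_nonneg_left (le_zcos_of_le 16 rfl (6 / 19) (by norm_num)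
      (by norm_num) (by norm_num)) (h.nonneg _)
  have h17 : α 17 * (7891 / 10000) ≤ α 17 * zcos 19 17 :=
    mul_le_mul_of_nonneg_left (le_zcos_of_le 17 rfl (4 / 19) (by norm_num)
      (by norm_num) (by norm_num)) (h.nonneg _)
  have h18 : α 18 * (9458 / 10000) ≤ α 18 * zcos 19 18 :=
    mul_le_mul_of_nonneg_left (le_zcos_of_le 18 rfl (2 / 19) (by norm_num)
      (by norm_num) (by norm_num)) (h.nonneg _)
  exact ⟨by linarith, by linarith⟩

lemma IsSumFreeProfile.eq_zero_7_0 {α : ZMod 7 → ℝ} (h : IsSumFreeProfile 7 α)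
    (hσ : 2 * ((1 : ℕ) : ℝ) < ∑ j, α j) : α 0 = 0 := by
  by_contra hi
  obtain ⟨hm₁, hm₂⟩ := h.mass_7 hσ
  have h0 := h.nonneg 0
  have h1 := h.nonneg 1
  have h2 := h.nonneg 2
  have h3 := h.nonneg 3
  have h4 := h.nonneg 4
  have h5 := h.nonneg 5
  have h6 := h.nonneg 6
  by_cases z2 : α 2 = 0
  · linarith [z2, h.double_of_eq 5 3 rfl, h.pair_of_eq 3 3 hi rfl, h.pair_of_eq 4 4 hi rfl]
  · by_cases z4 : α 4 = 0
    · linarith [z4, h.double_of_eq 5 3 rfl, h.pair_of_eq 2 2 hi rfl, h.pair_of_eq 3 3 hi rfl]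
    · by_cases z5 : α 5 = 0
      · linarith [z5, h.pair_of_eq 3 3 hi rfl, h.pair_of_eq 4 4 hi rfl,
          h.triple_of_eq 4 z2 z2 z4 rfl]
      · by_cases z3 : α 3 = 0
        · linarith [z3, h.pair_of_eq 4 4 hi rfl, h.triple_of_eq 2 z4 z5 z2 rfl]
        · by_cases z1 : α 1 = 0
          · by_cases z6 : α 6 = 0
            · linarith [z1, z6, h.triple_of_eq 2 hi z2 z2 rfl, h.triple_of_eq 4 hi z4 z4 rfl,
                h.triple_of_eq 5 hi z5 z5 rfl, h.triple_of_eq 3 hi z3 z3 rfl,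
                h.triple_of_eq 5 z2 z3 z5 rfl]
            · linarith [z1, h.triple_of_eq 4 hi z4 z4 rfl, h.triple_of_eq 4 z2 z2 z4 rfl,
                h.triple_of_eq 5 z2 z3 z5 rfl, h.triple_of_eq 3 z4 z6 z3 rfl,
                h.triple_of_eq 3 z5 z5 z3 rfl]
          · by_cases z6 : α 6 = 0
            · linarith [z6, h.triple_of_eq 4 hi z4 z4 rfl, h.triple_of_eq 3 hi z3 z3 rfl,
                h.triple_of_eq 5 z2 z3 z5 rfl, h.triple_of_eq 1 z4 z4 z1 rfl]
            · linarith [h.pair_of_eq 3 3 hi rfl, h.pair_of_eq 4 4 hi rfl,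
                h.triple_of_eq 5 z2 z3 z5 rfl, h.triple_of_eq 1 z4 z4 z1 rfl,
                h.triple_of_eq 3 z4 z6 z3 rfl]

lemma IsSumFreeProfile.eq_zero_7_1 {α : ZMod 7 → ℝ} (h : IsSumFreeProfile 7 α)
    (hσ : 2 * ((1 : ℕ) : ℝ) < ∑ j, α j) : α 1 = 0 := by
  by_contra hi
  obtain ⟨hm₁, hm₂⟩ := h.mass_7 hσ
  have h0 := h.nonneg 0
  have h1 := h.nonneg 1
  have h2 := h.nonneg 2
  have h3 := h.nonneg 3
  have h4 := h.nonneg 4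
  have h5 := h.nonneg 5
  have h6 := h.nonneg 6
  by_cases z2 : α 2 = 0
  · linarith [z2, h.double_of_eq 5 3 rfl, h.pair_of_eq 3 4 hi rfl, h.pair_of_eq 4 5 hi rfl]
  · by_cases z4 : α 4 = 0
    · linarith [z4, h.double_of_eq 1 2 rfl, h.double_of_eq 5 3 rfl, h.double_of_eq 6 5 rfl,
        h.pair_of_eq 2 3 hi rfl]
    · by_cases z5 : α 5 = 0
      · linarith [z5, h.pair_of_eq 2 3 hi rfl, h.pair_of_eq 3 4 hi rfl,
          h.triple_of_eq 4 z2 z2 z4 rfl]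
      · by_cases z3 : α 3 = 0
        · linarith [z3, h.pair_of_eq 4 6 z2 rfl, h.triple_of_eq 1 z4 z4 hi rfl,
            h.triple_of_eq 2 z4 z5 z2 rfl]
        · by_cases z6 : α 6 = 0
          · linarith [z6, h.pair_of_eq 3 4 hi rfl, h.triple_of_eq 4 hi z3 z4 rfl,
              h.triple_of_eq 5 z2 z3 z5 rfl, h.triple_of_eq 2 z4 z5 z2 rfl]
          · linarith [h.pair_of_eq 3 4 hi rfl, h.triple_of_eq 4 hi z3 z4 rfl,
              h.triple_of_eq 5 z2 z3 z5 rfl, h.triple_of_eq 2 z4 z5 z2 rfl,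
              h.triple_of_eq 3 z4 z6 z3 rfl]

lemma IsSumFreeProfile.eq_zero_13_0 {α : ZMod 13 → ℝ} (h : IsSumFreeProfile 13 α)
    (hσ : 2 * ((2 : ℕ) : ℝ) < ∑ j, α j) : α 0 = 0 := by
  by_contra hi
  obtain ⟨hm₁, hm₂⟩ := h.mass_13 hσ
  have h0 := h.nonneg 0
  have h1 := h.nonneg 1
  have h2 := h.nonneg 2
  have h3 := h.nonneg 3
  have h4 := h.nonneg 4
  have h5 := h.nonneg 5
  have h6 := h.nonneg 6
  have h7 := h.nonneg 7
  have h8 := h.nonneg 8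
  have h9 := h.nonneg 9
  have h10 := h.nonneg 10
  have h11 := h.nonneg 11
  have h12 := h.nonneg 12
  rcases h.double_triple_of_eq 10 7 rfl with t10 | t10 | t10
  · linarith [t10, h.double_of_eq 3 6 rfl, h.double_of_eq 4 8 rfl, h.double_of_eq 9 5 rfl,
      h.pair_of_eq 5 5 hi rfl, h.pair_of_eq 6 6 hi rfl, h.pair_of_eq 7 7 hi rfl,
      h.pair_of_eq 8 8 hi rfl]
  · linarith [t10, h.double_of_eq 3 6 rfl, h.double_of_eq 4 8 rfl, h.double_of_eq 5 10 rfl,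
      h.double_of_eq 9 5 rfl, h.pair_of_eq 6 6 hi rfl, h.pair_of_eq 8 8 hi rfl,
      h.pair_of_eq 9 9 hi rfl]
  · rcases h.double_triple_of_eq 5 10 rfl with t5 | t5 | t5
    · linarith [t5, h.double_of_eq 3 6 rfl, h.double_of_eq 4 8 rfl, h.pair_of_eq 6 6 hi rfl,
        h.pair_of_eq 7 7 hi rfl, h.pair_of_eq 8 8 hi rfl, h.pair_of_eq 9 9 hi rfl, t10]
    · linarith [t5, h.double_of_eq 3 6 rfl, h.double_of_eq 4 8 rfl, h.double_of_eq 9 5 rfl,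
        h.pair_of_eq 5 5 hi rfl, h.pair_of_eq 6 6 hi rfl, h.pair_of_eq 7 7 hi rfl,
        h.pair_of_eq 8 8 hi rfl]
    · rcases h.double_triple_of_eq 9 5 rfl with t9 | t9 | t9
      · linarith [t9, h.double_of_eq 3 6 rfl, h.double_of_eq 4 8 rfl, h.pair_of_eq 5 5 hi rfl,
          h.pair_of_eq 6 6 hi rfl, h.pair_of_eq 7 7 hi rfl, h.pair_of_eq 8 8 hi rfl, t5]
      · linarith [t9, h.double_of_eq 3 6 rfl, h.double_of_eq 4 8 rfl, h.pair_of_eq 6 6 hi rfl,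
          h.pair_of_eq 7 7 hi rfl, h.pair_of_eq 8 8 hi rfl, h.pair_of_eq 9 9 hi rfl, t10]
      · linarith [h.double_of_eq 3 6 rfl, h.double_of_eq 4 8 rfl, h.pair_of_eq 6 6 hi rfl,
          h.pair_of_eq 7 7 hi rfl, h.pair_of_eq 8 8 hi rfl, t10, t5, t9]

lemma IsSumFreeProfile.eq_zero_13_1 {α : ZMod 13 → ℝ} (h : IsSumFreeProfile 13 α)
    (hσ : 2 * ((2 : ℕ) : ℝ) < ∑ j, α j) : α 1 = 0 := by
  by_contra hi
  obtain ⟨hm₁, hm₂⟩ := h.mass_13 hσ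
  have h0 := h.nonneg 0
  have h1 := h.nonneg 1
  have h2 := h.nonneg 2
  have h3 := h.nonneg 3
  have h4 := h.nonneg 4
  have h5 := h.nonneg 5
  have h6 := h.nonneg 6
  have h7 := h.nonneg 7
  have h8 := h.nonneg 8
  have h9 := h.nonneg 9
  have h10 := h.nonneg 10
  have h11 := h.nonneg 11
  have h12 := h.nonneg 12
  rcases h.double_triple_of_eq 10 7 rfl with t10 | t10 | t10
  · linarith [t10, h.double_of_eq 3 6 rfl, h.double_of_eq 4 8 rfl, h.double_of_eq 9 5 rfl,
      h.pair_of_eq 4 5 hi rfl, h.pair_of_eq 5 6 hi rfl, h.pair_of_eq 6 7 hi rfl,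
      h.pair_of_eq 7 8 hi rfl]
  · linarith [t10, h.double_of_eq 3 6 rfl, h.double_of_eq 4 8 rfl, h.double_of_eq 5 10 rfl,
      h.double_of_eq 9 5 rfl, h.pair_of_eq 5 6 hi rfl, h.pair_of_eq 8 9 hi rfl,
      h.pair_of_eq 9 10 hi rfl]
  · rcases h.double_triple_of_eq 5 10 rfl with t5 | t5 | t5
    · linarith [t5, h.double_of_eq 3 6 rfl, h.double_of_eq 4 8 rfl, h.pair_of_eq 3 4 hi rfl,
        h.pair_of_eq 6 7 hi rfl, h.pair_of_eq 8 9 hi rfl, h.pair_of_eq 9 10 hi rfl, t10]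
    · linarith [t5, h.double_of_eq 3 6 rfl, h.double_of_eq 4 8 rfl, h.double_of_eq 9 5 rfl,
        h.pair_of_eq 4 5 hi rfl, h.pair_of_eq 5 6 hi rfl, h.pair_of_eq 6 7 hi rfl,
        h.pair_of_eq 7 8 hi rfl]
    · rcases h.double_triple_of_eq 9 5 rfl with t9 | t9 | t9
      · linarith [t9, h.double_of_eq 3 6 rfl, h.double_of_eq 4 8 rfl, h.pair_of_eq 4 5 hi rfl,
          h.pair_of_eq 5 6 hi rfl, h.pair_of_eq 6 7 hi rfl, h.pair_of_eq 7 8 hi rfl, t5]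
      · linarith [t9, h.double_of_eq 3 6 rfl, h.double_of_eq 4 8 rfl, h.pair_of_eq 3 4 hi rfl,
          h.pair_of_eq 6 7 hi rfl, h.pair_of_eq 8 9 hi rfl, h.pair_of_eq 9 10 hi rfl, t10]
      · linarith [h.double_of_eq 3 6 rfl, h.double_of_eq 4 8 rfl, h.pair_of_eq 3 4 hi rfl,
          h.pair_of_eq 6 7 hi rfl, h.pair_of_eq 7 8 hi rfl, t10, t5, t9]

lemma IsSumFreeProfile.eq_zero_13_2 {α : ZMod 13 → ℝ} (h : IsSumFreeProfile 13 α)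
    (hσ : 2 * ((2 : ℕ) : ℝ) < ∑ j, α j) : α 2 = 0 := by
  by_contra hi
  obtain ⟨hm₁, hm₂⟩ := h.mass_13 hσ
  have h0 := h.nonneg 0
  have h1 := h.nonneg 1
  have h2 := h.nonneg 2
  have h3 := h.nonneg 3
  have h4 := h.nonneg 4
  have h5 := h.nonneg 5
  have h6 := h.nonneg 6
  have h7 := h.nonneg 7
  have h8 := h.nonneg 8
  have h9 := h.nonneg 9
  have h10 := h.nonneg 10
  have h11 := h.nonneg 11
  have h12 := h.nonneg 12
  rcases h.double_triple_of_eq 10 7 rfl with t10 | t10 | t10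
  · linarith [t10, h.double_of_eq 3 6 rfl, h.double_of_eq 4 8 rfl, h.double_of_eq 9 5 rfl,
      h.pair_of_eq 4 6 hi rfl, h.pair_of_eq 5 7 hi rfl, h.pair_of_eq 6 8 hi rfl,
      h.pair_of_eq 7 9 hi rfl]
  · linarith [t10, h.double_of_eq 3 6 rfl, h.double_of_eq 4 8 rfl, h.double_of_eq 5 10 rfl,
      h.double_of_eq 9 5 rfl, h.pair_of_eq 4 6 hi rfl, h.pair_of_eq 6 8 hi rfl,
      h.pair_of_eq 8 10 hi rfl]
  · rcases h.double_triple_of_eq 5 10 rfl with t5 | t5 | t5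
    · linarith [t5, h.double_of_eq 3 6 rfl, h.double_of_eq 4 8 rfl, h.double_of_eq 7 1 rfl,
        h.double_of_eq 10 7 rfl, h.pair_of_eq 4 6 hi rfl, h.pair_of_eq 6 8 hi rfl,
        h.pair_of_eq 7 9 hi rfl]
    · linarith [t5, h.double_of_eq 3 6 rfl, h.double_of_eq 4 8 rfl, h.double_of_eq 9 5 rfl,
        h.pair_of_eq 4 6 hi rfl, h.pair_of_eq 5 7 hi rfl, h.pair_of_eq 6 8 hi rfl,
        h.pair_of_eq 7 9 hi rfl]
    · rcases h.double_triple_of_eq 9 5 rfl with t9 | t9 | t9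
      · linarith [t9, h.double_of_eq 3 6 rfl, h.double_of_eq 4 8 rfl, h.pair_of_eq 4 6 hi rfl,
          h.pair_of_eq 5 7 hi rfl, h.pair_of_eq 6 8 hi rfl, t10, t5]
      · linarith [t9, h.double_of_eq 3 6 rfl, h.double_of_eq 4 8 rfl, h.double_of_eq 7 1 rfl,
          h.double_of_eq 10 7 rfl, h.pair_of_eq 4 6 hi rfl, h.pair_of_eq 6 8 hi rfl,
          h.pair_of_eq 7 9 hi rfl]
      · linarith [h.double_of_eq 3 6 rfl, h.double_of_eq 4 8 rfl, h.pair_of_eq 4 6 hi rfl,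
          h.pair_of_eq 5 7 hi rfl, h.pair_of_eq 6 8 hi rfl, h.pair_of_eq 7 9 hi rfl, t10, t9]

lemma IsSumFreeProfile.eq_zero_19_0 {α : ZMod 19 → ℝ} (h : IsSumFreeProfile 19 α)
    (hσ : 2 * ((3 : ℕ) : ℝ) < ∑ j, α j) : α 0 = 0 := by
  by_contra hi
  obtain ⟨hm₁, hm₂⟩ := h.mass_19 hσ
  have h0 := h.nonneg 0
  have h1 := h.nonneg 1
  have h2 := h.nonneg 2
  have h3 := h.nonneg 3
  have h4 := h.nonneg 4
  have h5 := h.nonneg 5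
  have h6 := h.nonneg 6
  have h7 := h.nonneg 7
  have h8 := h.nonneg 8
  have h9 := h.nonneg 9
  have h10 := h.nonneg 10
  have h11 := h.nonneg 11
  have h12 := h.nonneg 12
  have h13 := h.nonneg 13
  have h14 := h.nonneg 14
  have h15 := h.nonneg 15
  have h16 := h.nonneg 16
  have h17 := h.nonneg 17
  have h18 := h.nonneg 18
  rcases h.double_triple_of_eq 5 10 rfl with t5 | t5 | t5
  · linarith [t5, h.double_of_eq 4 8 rfl, h.double_of_eq 6 12 rfl, h.double_of_eq 7 14 rfl,
      h.double_of_eq 13 7 rfl, h.double_of_eq 14 9 rfl, h.double_of_eq 15 11 rfl,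
      h.pair_of_eq 8 8 hi rfl, h.pair_of_eq 9 9 hi rfl, h.pair_of_eq 10 10 hi rfl,
      h.pair_of_eq 11 11 hi rfl, h.pair_of_eq 12 12 hi rfl]
  · linarith [t5, h.double_of_eq 4 8 rfl, h.double_of_eq 6 12 rfl, h.double_of_eq 7 14 rfl,
      h.double_of_eq 12 5 rfl, h.double_of_eq 13 7 rfl, h.double_of_eq 14 9 rfl,
      h.double_of_eq 15 11 rfl, h.pair_of_eq 5 5 hi rfl, h.pair_of_eq 8 8 hi rfl,
      h.pair_of_eq 9 9 hi rfl, h.pair_of_eq 11 11 hi rfl]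
  · linarith [h.double_of_eq 4 8 rfl, h.double_of_eq 6 12 rfl, h.double_of_eq 7 14 rfl,
      h.double_of_eq 13 7 rfl, h.double_of_eq 14 9 rfl, h.double_of_eq 15 11 rfl,
      h.pair_of_eq 8 8 hi rfl, h.pair_of_eq 9 9 hi rfl, h.pair_of_eq 10 10 hi rfl,
      h.pair_of_eq 11 11 hi rfl, h.pair_of_eq 12 12 hi rfl, t5]

lemma IsSumFreeProfile.eq_zero_19_1 {α : ZMod 19 → ℝ} (h : IsSumFreeProfile 19 α)
    (hσ : 2 * ((3 : ℕ) : ℝ) < ∑ j, α j) : α 1 = 0 := by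
  by_contra hi
  obtain ⟨hm₁, hm₂⟩ := h.mass_19 hσ
  have h0 := h.nonneg 0
  have h1 := h.nonneg 1
  have h2 := h.nonneg 2
  have h3 := h.nonneg 3
  have h4 := h.nonneg 4
  have h5 := h.nonneg 5
  have h6 := h.nonneg 6
  have h7 := h.nonneg 7
  have h8 := h.nonneg 8
  have h9 := h.nonneg 9
  have h10 := h.nonneg 10
  have h11 := h.nonneg 11
  have h12 := h.nonneg 12
  have h13 := h.nonneg 13
  have h14 := h.nonneg 14
  have h15 := h.nonneg 15
  have h16 := h.nonneg 16
  have h17 := h.nonneg 17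
  have h18 := h.nonneg 18
  rcases h.double_triple_of_eq 5 10 rfl with t5 | t5 | t5
  · linarith [t5, h.double_of_eq 4 8 rfl, h.double_of_eq 6 12 rfl, h.double_of_eq 7 14 rfl,
      h.double_of_eq 13 7 rfl, h.double_of_eq 15 11 rfl, h.pair_of_eq 8 9 hi rfl,
      h.pair_of_eq 9 10 hi rfl, h.pair_of_eq 10 11 hi rfl, h.pair_of_eq 12 13 hi rfl,
      h.pair_of_eq 13 14 hi rfl]
  · linarith [t5, h.double_of_eq 4 8 rfl, h.double_of_eq 6 12 rfl, h.double_of_eq 7 14 rfl,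
      h.double_of_eq 13 7 rfl, h.double_of_eq 14 9 rfl, h.double_of_eq 15 11 rfl,
      h.pair_of_eq 5 6 hi rfl, h.pair_of_eq 6 7 hi rfl, h.pair_of_eq 8 9 hi rfl,
      h.pair_of_eq 11 12 hi rfl, h.pair_of_eq 13 14 hi rfl]
  · linarith [h.double_of_eq 4 8 rfl, h.double_of_eq 6 12 rfl, h.double_of_eq 7 14 rfl,
      h.double_of_eq 13 7 rfl, h.double_of_eq 14 9 rfl, h.double_of_eq 15 11 rfl,
      h.pair_of_eq 8 9 hi rfl, h.pair_of_eq 9 10 hi rfl, h.pair_of_eq 10 11 hi rfl,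
      h.pair_of_eq 11 12 hi rfl, h.pair_of_eq 12 13 hi rfl, t5]

lemma IsSumFreeProfile.eq_zero_19_2 {α : ZMod 19 → ℝ} (h : IsSumFreeProfile 19 α)
    (hσ : 2 * ((3 : ℕ) : ℝ) < ∑ j, α j) : α 2 = 0 := by
  by_contra hi
  obtain ⟨hm₁, hm₂⟩ := h.mass_19 hσ
  have h0 := h.nonneg 0
  have h1 := h.nonneg 1
  have h2 := h.nonneg 2
  have h3 := h.nonneg 3
  have h4 := h.nonneg 4
  have h5 := h.nonneg 5
  have h6 := h.nonneg 6
  have h7 := h.nonneg 7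
  have h8 := h.nonneg 8
  have h9 := h.nonneg 9
  have h10 := h.nonneg 10
  have h11 := h.nonneg 11
  have h12 := h.nonneg 12
  have h13 := h.nonneg 13
  have h14 := h.nonneg 14
  have h15 := h.nonneg 15
  have h16 := h.nonneg 16
  have h17 := h.nonneg 17
  have h18 := h.nonneg 18
  rcases h.double_triple_of_eq 5 10 rfl with t5 | t5 | t5
  · linarith [t5, h.double_of_eq 4 8 rfl, h.double_of_eq 6 12 rfl, h.double_of_eq 7 14 rfl,
      h.double_of_eq 13 7 rfl, h.double_of_eq 14 9 rfl, h.double_of_eq 15 11 rfl,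
      h.pair_of_eq 4 6 hi rfl, h.pair_of_eq 7 9 hi rfl, h.pair_of_eq 8 10 hi rfl,
      h.pair_of_eq 9 11 hi rfl, h.pair_of_eq 10 12 hi rfl]
  · linarith [t5, h.double_of_eq 4 8 rfl, h.double_of_eq 8 16 rfl, h.double_of_eq 11 3 rfl,
      h.double_of_eq 12 5 rfl, h.double_of_eq 13 7 rfl, h.double_of_eq 14 9 rfl,
      h.double_of_eq 15 11 rfl, h.pair_of_eq 6 8 hi rfl, h.pair_of_eq 7 9 hi rfl,
      h.pair_of_eq 9 11 hi rfl, h.pair_of_eq 12 14 hi rfl, h.pair_of_eq 13 15 hi rfl]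
  · linarith [h.double_of_eq 4 8 rfl, h.double_of_eq 6 12 rfl, h.double_of_eq 7 14 rfl,
      h.double_of_eq 13 7 rfl, h.double_of_eq 14 9 rfl, h.double_of_eq 15 11 rfl,
      h.pair_of_eq 7 9 hi rfl, h.pair_of_eq 8 10 hi rfl, h.pair_of_eq 9 11 hi rfl,
      h.pair_of_eq 10 12 hi rfl, h.pair_of_eq 12 14 hi rfl, t5]

lemma IsSumFreeProfile.eq_zero_19_3 {α : ZMod 19 → ℝ} (h : IsSumFreeProfile 19 α)
    (hσ : 2 * ((3 : ℕ) : ℝ) < ∑ j, α j) : α 3 = 0 := by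
  by_contra hi
  obtain ⟨hm₁, hm₂⟩ := h.mass_19 hσ
  have h0 := h.nonneg 0
  have h1 := h.nonneg 1
  have h2 := h.nonneg 2
  have h3 := h.nonneg 3
  have h4 := h.nonneg 4
  have h5 := h.nonneg 5
  have h6 := h.nonneg 6
  have h7 := h.nonneg 7
  have h8 := h.nonneg 8
  have h9 := h.nonneg 9
  have h10 := h.nonneg 10
  have h11 := h.nonneg 11
  have h12 := h.nonneg 12
  have h13 := h.nonneg 13
  have h14 := h.nonneg 14
  have h15 := h.nonneg 15
  have h16 := h.nonneg 16
  have h17 := h.nonneg 17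
  have h18 := h.nonneg 18
  rcases h.double_triple_of_eq 5 10 rfl with t5 | t5 | t5
  · linarith [t5, h.double_of_eq 4 8 rfl, h.double_of_eq 6 12 rfl, h.double_of_eq 13 7 rfl,
      h.double_of_eq 14 9 rfl, h.double_of_eq 15 11 rfl, h.pair_of_eq 6 9 hi rfl,
      h.pair_of_eq 7 10 hi rfl, h.pair_of_eq 8 11 hi rfl, h.pair_of_eq 9 12 hi rfl,
      h.pair_of_eq 10 13 hi rfl]
  · linarith [t5, h.double_of_eq 4 8 rfl, h.double_of_eq 6 12 rfl, h.double_of_eq 7 14 rfl,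
      h.double_of_eq 12 5 rfl, h.double_of_eq 13 7 rfl, h.double_of_eq 14 9 rfl,
      h.double_of_eq 15 11 rfl, h.pair_of_eq 6 9 hi rfl, h.pair_of_eq 8 11 hi rfl,
      h.pair_of_eq 9 12 hi rfl]
  · linarith [h.double_of_eq 4 8 rfl, h.double_of_eq 6 12 rfl, h.double_of_eq 13 7 rfl,
      h.double_of_eq 14 9 rfl, h.double_of_eq 15 11 rfl, h.pair_of_eq 6 9 hi rfl,
      h.pair_of_eq 7 10 hi rfl, h.pair_of_eq 8 11 hi rfl, h.pair_of_eq 9 12 hi rfl,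
      h.pair_of_eq 10 13 hi rfl, t5]

lemma exceptional_cases {k i : ℕ} (hk : 1 ≤ k) (h5 : ¬ 5 ∣ 6 * k + 1) (hi : i ≤ k)
    (h13 : ¬ 13 ≤ k) (h7 : ¬ (i + 1 ≤ k ∧ 7 ≤ k)) (h2 : ¬ (i + 2 ≤ k ∧ 5 ≤ k)) :
    (k = 1 ∧ (i = 0 ∨ i = 1)) ∨ (k = 2 ∧ (i = 0 ∨ i = 1 ∨ i = 2)) ∨
    (k = 3 ∧ (i = 0 ∨ i = 1 ∨ i = 2 ∨ i = 3)) ∨ (k = 5 ∧ (i = 4 ∨ i = 5)) ∨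
    (k = 6 ∧ (i = 5 ∨ i = 6)) ∨ (k = 7 ∧ i = 7) ∨ (k = 8 ∧ i = 8) ∨ (k = 10 ∧ i = 10) ∨
    (k = 11 ∧ i = 11) ∨ (k = 12 ∧ i = 12) := by
  have h12 : k < 13 := by omega
  clear h13
  revert i
  interval_cases k <;> intro i hi <;> interval_cases i <;> revert h5 <;> decide

namespace IsSumFreeProfile

lemma natCast_eq_zero {q : ℕ} [NeZero q] {α : ZMod q → ℝ} (h : IsSumFreeProfile q α) {k : ℕ}
    (hk : 1 ≤ k) (hq : q = 6 * k + 1) (h5 : ¬ 5 ∣ q) (hσ : 2 * (k : ℝ) < ∑ j, α j) {i : ℕ}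
    (hi : i ≤ k) : α i = 0 := by
  by_cases h13 : 13 ≤ k
  · exact h.eq_zero_of_sin_le hk hq hσ hi
      (sin_mul_le_of_gap hq (e := 0) (by omega) (Or.inl ⟨rfl, h13⟩))
  by_cases h7 : i + 1 ≤ k ∧ 7 ≤ k
  · exact h.eq_zero_of_sin_le hk hq hσ hi
      (sin_mul_le_of_gap hq (e := 1) h7.1 (Or.inr (Or.inl ⟨rfl, h7.2⟩)))
  by_cases h2 : i + 2 ≤ k ∧ 5 ≤ k
  · exact h.eq_zero_of_sin_le hk hq hσ hi
      (sin_mul_le_of_gap hq (e := 2) h2.1 (Or.inr (Or.inr ⟨rfl, h2.2⟩)))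
  subst hq
  have hcases := exceptional_cases hk h5 hi h13 h7 h2
  rcases hcases with ⟨rfl, rfl | rfl⟩ | ⟨rfl, rfl | rfl | rfl⟩ | ⟨rfl, rfl | rfl | rfl | rfl⟩ |
    ⟨rfl, rfl | rfl⟩ | ⟨rfl, rfl | rfl⟩ | ⟨rfl, rfl⟩ | ⟨rfl, rfl⟩ | ⟨rfl, rfl⟩ | ⟨rfl, rfl⟩ |
    ⟨rfl, rfl⟩
  · exact h.eq_zero_7_0 hσ
  · exact h.eq_zero_7_1 hσ
  · exact h.eq_zero_13_0 hσ
  · exact h.eq_zero_13_1 hσ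
  · exact h.eq_zero_13_2 hσ
  · exact h.eq_zero_19_0 hσ
  · exact h.eq_zero_19_1 hσ
  · exact h.eq_zero_19_2 hσ
  · exact h.eq_zero_19_3 hσ
  · exact h.eq_zero_31_4 hσ
  · exact h.eq_zero_31_5 hσ
  · exact h.eq_zero_37_5 hσ
  · exact h.eq_zero_37_6 hσ
  · exact h.eq_zero_43_7 hσ
  · exact h.eq_zero_49_8 hσ
  · exact h.eq_zero_61_10 hσ
  · exact h.eq_zero_67_11 hσ
  · exact h.eq_zero_73_12 hσ

/-- A sum-free profile modulo `6k + 1` has mass at most `2k`. -/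
theorem sum_le {q : ℕ} [NeZero q] {α : ZMod q → ℝ} (h : IsSumFreeProfile q α) {k : ℕ}
    (hk : 1 ≤ k) (hq : q = 6 * k + 1) (h5 : ¬ 5 ∣ q) : ∑ j, α j ≤ 2 * k := by
  by_contra! hσ
  refine absurd (h.sum_le_of_support hq fun j hj => ?_) (not_le.2 hσ)
  have hneg : ∑ j, α (-j) = ∑ j, α j := Equiv.sum_comp (Equiv.neg (ZMod q)) α
  constructor
  · by_contra! hle
    refine hj ?_
    rw [← ZMod.natCast_zmod_val j]
    exact h.natCast_eq_zero hk hq h5 hσ hle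
  · by_contra! hlt
    have hval := j.val_lt
    refine hj ?_
    have h1 := h.comp_neg.natCast_eq_zero hk hq h5 (hneg ▸ hσ) (i := q - j.val) (by omega)
    simpa [Nat.cast_sub hval.le] using h1

end IsSumFreeProfile

/-! ### Mann's inequality via atoms -/

section Mann

open Finset
open scoped Pointwise

variable {H : Type*} [AddCommGroup H] [Fintype H] [DecidableEq H]

/-- An atom of `B`: a set minimising the boundary size `#(X + B) - #X` among the non-empty sets
with `X + B` proper, and of minimal cardinality among the minimisers. -/
structure IsSumAtom (B X : Finset H) : Prop where
  nonempty : X.Nonempty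
  ne_univ : X + B ≠ univ
  le : ∀ Y : Finset H, Y.Nonempty → Y + B ≠ univ → #(X + B) + #Y ≤ #(Y + B) + #X
  card_le : ∀ Y : Finset H, Y.Nonempty → Y + B ≠ univ → #(Y + B) + #X ≤ #(X + B) + #Y → #X ≤ #Y

lemma exists_isSumAtom {A B : Finset H} (hA : A.Nonempty) (hAB : A + B ≠ univ) :
    ∃ X, IsSumAtom B X := by
  let f : Finset H → ℤ := fun X => #(X + B) - #X
  let S : Finset (Finset H) := univ.filter fun X => X.Nonempty ∧ X + B ≠ univ
  obtain ⟨X₀, hX₀, hmin⟩ := S.exists_min_image f ⟨A, by simp [S, hA, hAB]⟩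
  obtain ⟨X, hX, hXmin⟩ := (S.filter fun X => f X = f X₀).exists_min_image card
    ⟨X₀, by simp [hX₀]⟩
  simp only [mem_filter, mem_univ, true_and, S, f] at hX hXmin hmin
  refine ⟨X, hX.1.1, hX.1.2, fun Y h1 h2 => ?_, fun Y h1 h2 h3 => hXmin Y ⟨⟨h1, h2⟩, ?_⟩⟩
  · have := hmin Y ⟨h1, h2⟩
    omega
  · have := hmin Y ⟨h1, h2⟩
    omega

lemma compl_add_neg_subset (X B : Finset H) : (X + B)ᶜ + -B ⊆ Xᶜ := by
  intro z hz
  obtain ⟨y, hy, b, hb, rfl⟩ := mem_add.1 hz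
  rw [mem_compl] at hy ⊢
  intro hx
  refine hy (mem_add.2 ⟨_, hx, -b, by simpa using hb, by simp⟩)

namespace IsSumAtom

variable {B X Y : Finset H}

lemma vadd (h : IsSumAtom B X) (t : H) : IsSumAtom B (t +ᵥ X) where
  nonempty := h.nonempty.vadd_finset
  ne_univ := by
    rw [vadd_add_assoc]
    intro huniv
    refine h.ne_univ (eq_univ_of_card _ ?_)
    rw [← card_vadd_finset t, huniv, card_univ]
  le := by
    simp only [vadd_add_assoc, card_vadd_finset]
    exact h.le
  card_le := by
    simp only [vadd_add_assoc, card_vadd_finset]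
    exact h.card_le

/-- If `X` is no larger than the atoms of `-B`, it is no larger than the complement of `X + B`. -/
lemma two_mul_card_le (h : IsSumAtom B X) {X' : Finset H} (h' : IsSumAtom (-B) X')
    (hle : #X ≤ #X') : #(X + B) + #X ≤ Fintype.card H := by
  have hX : #(X + B) + #(X + B)ᶜ = Fintype.card H := card_add_card_compl _
  have hne : (X + B)ᶜ.Nonempty := by
    rw [nonempty_iff_ne_empty, Ne, compl_eq_empty_iff]
    exact h.ne_univ
  have hsub := card_le_card (compl_add_neg_subset X B)
  have hXc : #X + #Xᶜ = Fintype.card H := card_add_card_compl _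
  have hadm : (X + B)ᶜ + -B ≠ univ := by
    intro huniv
    rw [huniv, card_univ] at hsub
    have := h.nonempty.card_pos
    omega
  have hsub' := card_le_card (compl_add_neg_subset X' (-B))
  rw [neg_neg] at hsub'
  have hX' : #(X' + -B) + #(X' + -B)ᶜ = Fintype.card H := card_add_card_compl _
  have hXc' : #X' + #X'ᶜ = Fintype.card H := card_add_card_compl _
  have hne' : (X' + -B)ᶜ.Nonempty := by
    rw [nonempty_iff_ne_empty, Ne, compl_eq_empty_iff]
    exact h'.ne_univ
  have hadm' : (X' + -B)ᶜ + B ≠ univ := by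
    intro huniv
    rw [huniv, card_univ] at hsub'
    have := h'.nonempty.card_pos
    omega
  have h1 := h.le _ hne' hadm'
  have h2 := h'.card_le _ hne hadm (by omega)
  omega

lemma subset_of_inter_nonempty (h : IsSumAtom B X) (hY : IsSumAtom B Y) (hcard : #X = #Y)
    (hhalf : #(X + B) + #X ≤ Fintype.card H) (hXY : (X ∩ Y).Nonempty) : X ⊆ Y := by
  have hI : (X ∩ Y) + B ⊆ (X + B) ∩ (Y + B) := inter_add_subset
  have hU : (X ∪ Y) + B = (X + B) ∪ (Y + B) := union_add
  have hadm : (X ∩ Y) + B ≠ univ := fun huniv =>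
    h.ne_univ (univ_subset_iff.1 (huniv ▸ hI.trans inter_subset_left))
  have h1 := card_union_add_card_inter X Y
  have h2 := card_union_add_card_inter (X + B) (Y + B)
  have h3 := card_le_card hI
  have h4 := h.le _ hY.nonempty hY.ne_univ
  have h5 := hY.le _ h.nonempty h.ne_univ
  have h6 := h.le _ hXY hadm
  rw [← hU] at h2
  have hle : #X ≤ #(X ∩ Y) := by
    by_cases huniv : (X ∪ Y) + B = univ
    · rw [huniv, card_univ] at h2
      have := hXY.card_pos
      omega
    · have h7 := h.le _ (h.nonempty.mono subset_union_left) huniv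
      exact h.card_le _ hXY hadm (by omega)
  exact inter_eq_left.1 (eq_of_subset_of_card_le inter_subset_left hle)

lemma exists_addSubgroup (h : IsSumAtom B X) {X' : Finset H} (h' : IsSumAtom (-B) X')
    (hle : #X ≤ #X') (hB : B.Nonempty) :
    ∃ K : AddSubgroup H, K ≠ ⊤ ∧ ∀ A : Finset H, A.Nonempty → A + B ≠ univ →
      #A + #B ≤ #(A + B) + Nat.card K := by
  obtain ⟨x, hx⟩ := h.nonempty
  set Z := -x +ᵥ X with hZdef
  have hZ : IsSumAtom B Z := h.vadd (-x)
  have hZcard : #Z = #X := card_vadd_finset _ _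
  have h0 : (0 : H) ∈ Z := mem_vadd_finset.2 ⟨x, hx, by simp⟩
  have hhalf := hZ.two_mul_card_le h' (hZcard.trans_le hle)
  have hsub : ∀ z ∈ Z, ∀ y ∈ Z, y - z ∈ Z := by
    intro z hz y hy
    have h1 : (Z ∩ (z +ᵥ Z)).Nonempty :=
      ⟨z, mem_inter.2 ⟨hz, mem_vadd_finset.2 ⟨0, h0, by simp⟩⟩⟩
    have h2 := hZ.subset_of_inter_nonempty (hZ.vadd z) (card_vadd_finset _ _).symm hhalf h1 hy
    obtain ⟨w, hw, rfl⟩ := mem_vadd_finset.1 h2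
    simpa using hw
  have hneg : ∀ z ∈ Z, -z ∈ Z := fun z hz => by simpa using hsub z hz 0 h0
  let K : AddSubgroup H :=
    { carrier := Z
      zero_mem' := h0
      add_mem' := fun {a b} ha hb => by simpa using hsub (-b) (hneg b hb) a ha
      neg_mem' := fun {a} ha => hneg a ha }
  have hKcard : Nat.card K = #Z := by
    change Nat.card (Z : Set H) = _
    simp
  refine ⟨K, ?_, fun A hA hAB => ?_⟩
  · rintro hK
    have hZuniv : Z = univ := by
      ext z
      simp only [mem_univ, iff_true]
      exact (hK ▸ AddSubgroup.mem_top z : z ∈ K)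
    refine hZ.ne_univ ?_
    rw [hZuniv]
    obtain ⟨b, hb⟩ := hB
    ext y
    simp only [mem_univ, iff_true]
    exact mem_add.2 ⟨y - b, mem_univ _, b, hb, by simp⟩
  · have h1 := hZ.le A hA hAB
    have h2 : #B ≤ #(Z + B) := card_le_card_add_left ⟨0, h0⟩
    omega

end IsSumAtom

/-- **Mann's inequality**. -/
theorem exists_addSubgroup_card_add_card_le {A B : Finset H} (hA : A.Nonempty) (hB : B.Nonempty)
    (hAB : A + B ≠ univ) :
    ∃ K : AddSubgroup H, K ≠ ⊤ ∧ #A + #B ≤ #(A + B) + Nat.card K := by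
  have hneg : -A + -B ≠ univ := by
    intro huniv
    refine hAB (eq_univ_of_card _ ?_)
    rw [← card_neg, neg_add, huniv, card_univ]
  obtain ⟨X, hX⟩ := exists_isSumAtom hA hAB
  obtain ⟨X', hX'⟩ := exists_isSumAtom hA.neg hneg
  rcases le_total #X #X' with hle | hle
  · obtain ⟨K, hK, h⟩ := hX.exists_addSubgroup hX' hle hB
    exact ⟨K, hK, h A hA hAB⟩
  · obtain ⟨K, hK, h⟩ := hX'.exists_addSubgroup ((neg_neg B).symm ▸ hX) hle hB.neg
    have := h _ hA.neg hneg
    rw [← neg_add, card_neg, card_neg, card_neg] at this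
    exact ⟨K, hK, this⟩

end Mann

/-! ### Characters of finite abelian groups -/

section Characters

lemma AddChar.orderOf_dvd_exponent {G : Type*} [AddCommGroup G] (ψ : AddChar G ℂ) :
    orderOf ψ ∣ AddMonoid.exponent G := by
  refine orderOf_dvd_of_pow_eq_one (DFunLike.ext _ _ fun x => ?_)
  rw [AddChar.pow_apply, ← AddChar.map_nsmul_eq_pow, AddMonoid.exponent_nsmul_eq_zero,
    AddChar.map_zero_eq_one, AddChar.one_apply]

variable {G : Type*} [AddCommGroup G] [Fintype G]

lemma AddChar.exists_orderOf_eq_exponent :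
    ∃ ψ : AddChar G ℂ, orderOf ψ = AddMonoid.exponent G := by
  obtain ⟨ψ, hψ⟩ := Monoid.exists_orderOf_eq_exponent
    (Monoid.ExponentExists.of_finite (G := AddChar G ℂ))
  refine ⟨ψ, Nat.dvd_antisymm ψ.orderOf_dvd_exponent ?_⟩
  rw [hψ, AddMonoid.exponent_dvd_iff_forall_nsmul_eq_zero]
  refine fun x => AddChar.forall_apply_eq_zero.1 fun χ => ?_
  rw [AddChar.map_nsmul_eq_pow, ← AddChar.pow_apply, Monoid.pow_exponent_eq_one, AddChar.one_apply]

lemma AddChar.exists_surjective_stdAddChar_eq (ψ : AddChar G ℂ) {q : ℕ} [NeZero q]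
    (hq : orderOf ψ = q) :
    ∃ φ : G →+ ZMod q, Function.Surjective φ ∧ ∀ x, ψ x = ZMod.stdAddChar (φ x) := by
  have key : ∀ x, ∃ j : ZMod q, ψ x = ZMod.stdAddChar j := fun x => by
    have h1 : ψ x ^ q = 1 := by
      rw [← AddChar.pow_apply, ← hq, pow_orderOf_eq_one, AddChar.one_apply]
    obtain ⟨i, -, hi⟩ := (Complex.isPrimitiveRoot_exp q (NeZero.ne q)).eq_pow_of_pow_eq_one h1
    refine ⟨(i : ℤ), ?_⟩
    rw [ZMod.stdAddChar_coe, ← hi, ← Complex.exp_nat_mul]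
    congr 1
    push_cast
    ring
  choose f hf using key
  let φ : G →+ ZMod q := AddMonoidHom.mk' f fun x y => ZMod.injective_stdAddChar <| by
    rw [← hf, AddChar.map_add_eq_mul, AddChar.map_add_eq_mul, ← hf, ← hf]
  refine ⟨φ, ?_, hf⟩
  have hdvd : q ∣ Nat.card φ.range := by
    refine hq.symm.dvd.trans (orderOf_dvd_of_pow_eq_one (DFunLike.ext _ _ fun x => ?_))
    have h0 : Nat.card φ.range • f x = 0 := by
      have := congrArg Subtype.val (card_nsmul_eq_zero' (x := (⟨φ x, x, rfl⟩ : φ.range)))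
      simpa [φ] using this
    rw [AddChar.pow_apply, hf, ← AddChar.map_nsmul_eq_pow, h0, AddChar.map_zero_eq_one,
      AddChar.one_apply]
  rw [← AddMonoidHom.range_eq_top]
  refine AddSubgroup.eq_top_of_le_card _ ?_
  rw [Nat.card_zmod]
  exact Nat.le_of_dvd Nat.card_pos hdvd

lemma re_stdAddChar {q : ℕ} [NeZero q] (j : ZMod q) : (ZMod.stdAddChar j).re = zcos q j := by
  obtain ⟨n, rfl⟩ := ZMod.intCast_surjective j
  rw [zcos_intCast, ZMod.stdAddChar_coe,
    show (2 * π * Complex.I * n / q : ℂ) = ((2 * π * n / q : ℝ) : ℂ) * Complex.I by push_cast; ring,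
    Complex.exp_ofReal_mul_I_re]

lemma AddChar.sum_norm_sq_sum [DecidableEq G] (A : Finset G) :
    ∑ ψ : AddChar G ℂ, ‖∑ a ∈ A, ψ a‖ ^ 2 = (Fintype.card G * A.card : ℝ) := by
  have h : (∑ ψ : AddChar G ℂ, (‖∑ a ∈ A, ψ a‖ ^ 2 : ℂ)) = Fintype.card G * A.card := by
    calc ∑ ψ : AddChar G ℂ, (‖∑ a ∈ A, ψ a‖ ^ 2 : ℂ)
        = ∑ ψ : AddChar G ℂ, ∑ a ∈ A, ∑ b ∈ A, ψ (a - b) := by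
          refine Finset.sum_congr rfl fun ψ _ => ?_
          rw [← Complex.mul_conj', map_sum, Finset.sum_mul_sum]
          simp [sub_eq_add_neg, AddChar.map_add_eq_mul, AddChar.map_neg_eq_conj]
      _ = ∑ a ∈ A, ∑ b ∈ A, ∑ ψ : AddChar G ℂ, ψ (a - b) := by
          rw [Finset.sum_comm]
          exact Finset.sum_congr rfl fun a _ => Finset.sum_comm
      _ = _ := by
          simp [AddChar.sum_apply_eq_ite, sub_eq_zero, mul_comm]
  exact_mod_cast h

lemma AddChar.sum_mul_norm_sq_sum [DecidableEq G] {A : Finset G}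
    (hA : ∀ a ∈ A, ∀ b ∈ A, a + b ∉ A) :
    ∑ ψ : AddChar G ℂ, (∑ a ∈ A, ψ a).re * ‖∑ a ∈ A, ψ a‖ ^ 2 = 0 := by
  have h : (∑ ψ : AddChar G ℂ, (∑ a ∈ A, ψ a) * (‖∑ a ∈ A, ψ a‖ ^ 2 : ℂ)) = 0 := by
    calc ∑ ψ : AddChar G ℂ, (∑ a ∈ A, ψ a) * (‖∑ a ∈ A, ψ a‖ ^ 2 : ℂ)
        = ∑ ψ : AddChar G ℂ, ∑ a ∈ A, ∑ b ∈ A, ∑ c ∈ A, ψ (a + b - c) := by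
          refine Finset.sum_congr rfl fun ψ _ => ?_
          rw [← Complex.mul_conj', map_sum, Finset.sum_mul_sum, Finset.sum_mul_sum]
          simp_rw [Finset.mul_sum]
          simp [sub_eq_add_neg, AddChar.map_add_eq_mul, AddChar.map_neg_eq_conj, mul_assoc]
      _ = ∑ a ∈ A, ∑ b ∈ A, ∑ c ∈ A, ∑ ψ : AddChar G ℂ, ψ (a + b - c) := by
          rw [Finset.sum_comm]
          refine Finset.sum_congr rfl fun a _ => ?_
          rw [Finset.sum_comm]
          exact Finset.sum_congr rfl fun b _ => Finset.sum_comm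
      _ = 0 := by
          refine Finset.sum_eq_zero fun a ha => Finset.sum_eq_zero fun b hb =>
            Finset.sum_eq_zero fun c hc => ?_
          rw [AddChar.sum_apply_eq_ite, if_neg]
          rw [sub_eq_zero]
          rintro rfl
          exact hA a ha b hb hc
  have := congrArg Complex.re h
  rw [Complex.re_sum] at this
  simpa [← Complex.ofReal_pow, Complex.re_mul_ofReal] using this

/-- A sum-free set has a non-trivial Fourier coefficient with large negative real part. -/
lemma exists_addChar_sum_re_le {A : Finset G} (hne : A.Nonempty)
    (hA : ∀ a ∈ A, ∀ b ∈ A, a + b ∉ A) :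
    ∃ ψ : AddChar G ℂ, ψ ≠ 1 ∧
      (A.card : ℝ) ^ 2 ≤ -((Fintype.card G - A.card) * (∑ a ∈ A, ψ a).re) := by
  classical
  by_contra! hcon
  have h2 := AddChar.sum_norm_sq_sum A
  have h3 := AddChar.sum_mul_norm_sq_sum hA
  rw [← Finset.add_sum_erase _ _ (Finset.mem_univ (1 : AddChar G ℂ))] at h2 h3
  simp only [AddChar.one_apply, Finset.sum_const, nsmul_eq_mul, mul_one, Complex.natCast_re,
    Complex.norm_natCast] at h2 h3
  set n : ℝ := (Fintype.card G : ℝ)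
  have hpos : (0 : ℝ) < A.card := by exact_mod_cast hne.card_pos
  have h0 : (0 : G) ∉ A := fun h => hA 0 h 0 h (by simpa using h)
  have hlt : (A.card : ℝ) < n := Nat.cast_lt.2 (Finset.card_lt_univ_of_notMem h0)
  have key : 0 < ∑ ψ ∈ Finset.univ.erase (1 : AddChar G ℂ), ((n - A.card) * (∑ a ∈ A, ψ a).re +
      A.card ^ 2) * ‖∑ a ∈ A, ψ a‖ ^ 2 := by
    refine Finset.sum_pos' (fun ψ hψ => ?_) ?_
    · have := hcon ψ (Finset.ne_of_mem_erase hψ)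
      exact mul_nonneg (by linarith) (sq_nonneg _)
    · by_contra! hz
      have : ∑ ψ ∈ Finset.univ.erase (1 : AddChar G ℂ), ‖∑ a ∈ A, ψ a‖ ^ 2 = 0 := by
        refine Finset.sum_eq_zero fun ψ hψ => ?_
        have h1 := hcon ψ (Finset.ne_of_mem_erase hψ)
        have h4 := hz ψ hψ
        have h5 := sq_nonneg ‖∑ a ∈ A, ψ a‖
        refine le_antisymm ?_ h5
        by_contra! h6
        have := mul_pos (show 0 < (n - A.card) * (∑ a ∈ A, ψ a).re + A.card ^ 2 by linarith) h6
        linarith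
      rw [this] at h2
      nlinarith
  have heq : ∑ ψ ∈ Finset.univ.erase (1 : AddChar G ℂ), ((n - A.card) * (∑ a ∈ A, ψ a).re +
      A.card ^ 2) * ‖∑ a ∈ A, ψ a‖ ^ 2 = (n - A.card) *
      ∑ ψ ∈ Finset.univ.erase (1 : AddChar G ℂ), (∑ a ∈ A, ψ a).re * ‖∑ a ∈ A, ψ a‖ ^ 2 +
      A.card ^ 2 * ∑ ψ ∈ Finset.univ.erase (1 : AddChar G ℂ), ‖∑ a ∈ A, ψ a‖ ^ 2 := by
    rw [Finset.mul_sum, Finset.mul_sum, ← Finset.sum_add_distrib]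
    exact Finset.sum_congr rfl fun ψ _ => by ring
  rw [heq, eq_sub_of_add_eq' h3, eq_sub_of_add_eq' h2] at key
  refine key.ne' ?_
  ring

end Characters

/-! ### The profile of a sum-free set -/

section Profile

variable {G : Type*} [AddCommGroup G] [Fintype G] {q : ℕ}

lemma card_ker_mul_eq {φ : G →+ ZMod q} (hφ : Function.Surjective φ) :
    Nat.card φ.ker * q = Fintype.card G := by
  rw [← Nat.card_eq_fintype_card, ← AddSubgroup.card_mul_index φ.ker, AddSubgroup.index_ker,
    AddMonoidHom.range_eq_top.2 hφ, AddSubgroup.card_top, Nat.card_zmod]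

variable [DecidableEq G] (φ : G →+ ZMod q)

/-- The fibre of `A` through `x`, translated to the kernel of `φ`. -/
def kerFiber (A : Finset G) (x : G) : Finset φ.ker := Finset.univ.filter fun k => (k : G) + x ∈ A

lemma mem_kerFiber {A : Finset G} {x : G} {k : φ.ker} : k ∈ kerFiber φ A x ↔ (k : G) + x ∈ A := by
  simp [kerFiber]

lemma card_kerFiber (A : Finset G) (x : G) :
    (kerFiber φ A x).card = (A.filter fun a => φ a = φ x).card := by
  refine Finset.card_bij (fun k _ => (k : G) + x) (fun k hk => ?_) (fun k _ l _ h => ?_)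
    fun a ha => ?_
  · have : φ k = 0 := k.2
    simp [(mem_kerFiber φ).1 hk, this]
  · exact Subtype.ext (add_right_cancel h)
  · rw [Finset.mem_filter] at ha
    refine ⟨⟨a - x, by simp [AddMonoidHom.mem_ker, ha.2]⟩, ?_, by simp⟩
    rw [mem_kerFiber]
    simpa using ha.1

open scoped Pointwise in
lemma card_add_add_card_kerFiber_le {A : Finset G} (hA : ∀ a ∈ A, ∀ b ∈ A, a + b ∉ A) (x y : G) :
    (kerFiber φ A x + kerFiber φ A y).card + (kerFiber φ A (x + y)).card ≤ Nat.card φ.ker := by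
  have hd : Disjoint (kerFiber φ A x + kerFiber φ A y) (kerFiber φ A (x + y)) := by
    rw [Finset.disjoint_left]
    intro k hk hk'
    obtain ⟨u, hu, v, hv, rfl⟩ := Finset.mem_add.1 hk
    rw [mem_kerFiber] at hu hv hk'
    refine hA _ hu _ hv ?_
    convert hk' using 1
    push_cast
    abel
  rw [← Finset.card_union_of_disjoint hd, Nat.card_eq_fintype_card]
  exact Finset.card_le_univ _

variable [NeZero q]

open scoped Pointwise in
/-- The fibre densities of a sum-free set along `φ` form a profile, if the corresponding Fourier
coefficient is sufficiently negative. -/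
lemma isSumFreeProfile_of_sum_zcos_le {φ : G →+ ZMod q} (hφ : Function.Surjective φ)
    (hdvd : ∀ d, d ∣ Fintype.card G → d ≠ 1 → 7 ≤ d) {A : Finset G}
    (hA : ∀ a ∈ A, ∀ b ∈ A, a + b ∉ A)
    (hsp : (A.card : ℝ) ^ 2 ≤ -((Fintype.card G - A.card) * ∑ a ∈ A, zcos q (φ a))) :
    IsSumFreeProfile q
      fun j => ((A.filter fun a => φ a = j).card : ℝ) / (Nat.card φ.ker : ℝ) := by
  have hpos : (0 : ℝ) < Nat.card φ.ker := by exact_mod_cast Nat.card_pos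
  have hmul : (Nat.card φ.ker : ℝ) * q = Fintype.card G := by exact_mod_cast card_ker_mul_eq hφ
  have hsum : ∑ j, ((A.filter fun a => φ a = j).card : ℝ) / (Nat.card φ.ker : ℝ) =
      A.card / Nat.card φ.ker := by
    rw [← Finset.sum_div, ← Nat.cast_sum, ← Finset.card_eq_sum_card_fiberwise]
    exact fun _ _ => Finset.mem_coe.2 (Finset.mem_univ _)
  have hcos : ∑ j, ((A.filter fun a => φ a = j).card : ℝ) / (Nat.card φ.ker : ℝ) * zcos q j =
      (∑ a ∈ A, zcos q (φ a)) / Nat.card φ.ker := by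
    rw [← Finset.sum_fiberwise A φ, Finset.sum_div]
    refine Finset.sum_congr rfl fun j _ => ?_
    rw [Finset.sum_congr rfl (g := fun _ => zcos q j)
      fun a ha => by rw [(Finset.mem_filter.1 ha).2], Finset.sum_const, nsmul_eq_mul]
    ring
  have hnonempty : ∀ x, ((A.filter fun a => φ a = φ x).card : ℝ) / (Nat.card φ.ker : ℝ) ≠ 0 →
      (kerFiber φ A x).Nonempty := by
    intro x hx
    rw [← Finset.card_pos, card_kerFiber, Nat.pos_iff_ne_zero]
    intro h
    simp [h] at hx
  refine ⟨fun j => by positivity, fun s j hs => ?_, fun a b ha hb hab => ?_, ?_, ?_⟩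
  · obtain ⟨x, rfl⟩ := hφ s
    obtain ⟨y, rfl⟩ := hφ j
    rw [← map_add, ← add_div, div_le_one hpos]
    have h1 := card_add_add_card_kerFiber_le φ hA y x
    have h2 := Finset.card_le_card_add_right (s := kerFiber φ A y) (hnonempty x hs)
    rw [← card_kerFiber, ← card_kerFiber]
    exact_mod_cast (by omega : (kerFiber φ A y).card + (kerFiber φ A (y + x)).card ≤ Nat.card φ.ker)
  · obtain ⟨x, rfl⟩ := hφ a
    obtain ⟨y, rfl⟩ := hφ b
    rw [← map_add] at hab ⊢
    rw [← add_div, ← add_div, div_le_iff₀ hpos]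
    have h1 := card_add_add_card_kerFiber_le φ hA x y
    have hne : kerFiber φ A x + kerFiber φ A y ≠ Finset.univ := by
      intro h
      rw [h, Finset.card_univ, ← Nat.card_eq_fintype_card] at h1
      have := (hnonempty _ hab).card_pos
      omega
    obtain ⟨K, hK, h2⟩ := exists_addSubgroup_card_add_card_le (hnonempty x ha) (hnonempty y hb) hne
    have h3 : Nat.card K * 7 ≤ Nat.card φ.ker := by
      rw [← K.card_mul_index]
      refine Nat.mul_le_mul_left _ (hdvd _ ?_ fun h => hK (AddSubgroup.index_eq_one.1 h))
      exact K.index_dvd_card.trans (Dvd.intro _ (card_ker_mul_eq hφ))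
    rw [← card_kerFiber, ← card_kerFiber, ← card_kerFiber]
    have h4 : 7 * ((kerFiber φ A x).card + (kerFiber φ A y).card + (kerFiber φ A (x + y)).card) ≤
        8 * Nat.card φ.ker := by omega
    have h5 : (7 : ℝ) * ((kerFiber φ A x).card + (kerFiber φ A y).card +
        (kerFiber φ A (x + y)).card) ≤ 8 * Nat.card φ.ker := by exact_mod_cast h4
    linarith
  · rw [hsum, div_lt_iff₀ hpos, mul_comm, hmul]
    have h0 : (0 : G) ∉ A := fun h => hA 0 h 0 h (by simpa using h)
    exact_mod_cast Finset.card_lt_univ_of_notMem h0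
  · rw [hsum, hcos, div_pow, div_le_iff₀ (by positivity)]
    rw [← hmul] at hsp
    refine hsp.trans_eq ?_
    field_simp

/-- The upper bound for the size of a sum-free set. -/
lemma card_mul_le_of_sumFree (hdvd : ∀ d, d ∣ Fintype.card G → d % 6 = 1)
    (h5 : ¬ 5 ∣ Fintype.card G) {A : Finset G} (hA : ∀ a ∈ A, ∀ b ∈ A, a + b ∉ A) :
    3 * AddMonoid.exponent G * A.card ≤ Fintype.card G * (AddMonoid.exponent G - 1) := by
  obtain rfl | hne := A.eq_empty_or_nonempty
  · simp
  obtain ⟨ψ, hψ, hle⟩ := exists_addChar_sum_re_le hne hA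
  obtain ⟨q, hq⟩ : ∃ q, orderOf ψ = q := ⟨_, rfl⟩
  have hqm : q ∣ AddMonoid.exponent G := hq ▸ ψ.orderOf_dvd_exponent
  have hqn : q ∣ Fintype.card G := hqm.trans AddGroup.exponent_dvd_card
  have : NeZero q := ⟨fun h => Fintype.card_ne_zero (Nat.eq_zero_of_zero_dvd (h ▸ hqn))⟩
  obtain ⟨φ, hφ, hφψ⟩ := ψ.exists_surjective_stdAddChar_eq hq
  have hq6 := hdvd q hqn
  have hq1 : q ≠ 1 := fun h => hψ (orderOf_eq_one_iff.1 (hq.trans h))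
  obtain ⟨k, hk⟩ : ∃ k, q = 6 * k + 1 := ⟨q / 6, by omega⟩
  have hprof := isSumFreeProfile_of_sum_zcos_le hφ (fun d hd h1 => by have := hdvd d hd; omega) hA
    (by simpa only [Complex.re_sum, hφψ, re_stdAddChar] using hle)
  have hsum := hprof.sum_le (by omega) hk fun h => h5 (h.trans hqn)
  have hpos : (0 : ℝ) < Nat.card φ.ker := by exact_mod_cast Nat.card_pos
  rw [← Finset.sum_div, ← Nat.cast_sum, ← Finset.card_eq_sum_card_fiberwise
    fun _ _ => Finset.mem_coe.2 (Finset.mem_univ _), div_le_iff₀ hpos] at hsum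
  have hcard : A.card ≤ 2 * k * Nat.card φ.ker := by exact_mod_cast hsum
  have hmul := card_ker_mul_eq hφ
  obtain ⟨c, hc⟩ := hqm
  have hc0 : 1 ≤ c := by
    rw [Nat.one_le_iff_ne_zero]
    rintro rfl
    exact AddMonoid.exponent_ne_zero_of_finite hc
  have h6 : 6 * k * c ≤ AddMonoid.exponent G - 1 := by
    rw [hc, hk]
    have : (6 * k + 1) * c = 6 * k * c + c := by ring
    omega
  calc 3 * AddMonoid.exponent G * A.card ≤ 3 * (q * c) * (2 * k * Nat.card φ.ker) := by
        rw [hc]; gcongr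
    _ = (Nat.card φ.ker * q) * (6 * k * c) := by ring
    _ ≤ _ := by rw [hmul]; gcongr

lemma ZMod.sum_notMem_middle_third {l : ℕ} {x y : ZMod (3 * l + 1)}
    (hx : l < x.val ∧ x.val ≤ 2 * l) (hy : l < y.val ∧ y.val ≤ 2 * l) :
    ¬ (l < (x + y).val ∧ (x + y).val ≤ 2 * l) := by
  rw [ZMod.val_add]
  obtain h | h := lt_or_ge (x.val + y.val) (3 * l + 1)
  · rw [Nat.mod_eq_of_lt h]
    omega
  · rw [Nat.mod_eq_sub_mod h, Nat.mod_eq_of_lt (by omega)]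
    omega

/-- The preimage of the middle third of a cyclic quotient is a large sum-free set. -/
lemma exists_sumFree_card_eq (hm : AddMonoid.exponent G % 3 = 1) :
    ∃ A : Finset G, (∀ a ∈ A, ∀ b ∈ A, a + b ∉ A) ∧
      3 * AddMonoid.exponent G * A.card = Fintype.card G * (AddMonoid.exponent G - 1) := by
  obtain ⟨l, hl⟩ : ∃ l, AddMonoid.exponent G = 3 * l + 1 := ⟨AddMonoid.exponent G / 3, by omega⟩
  obtain ⟨ψ, hψ⟩ := AddChar.exists_orderOf_eq_exponent (G := G)
  obtain ⟨φ, hφ, -⟩ := ψ.exists_surjective_stdAddChar_eq (hψ.trans hl)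
  let J : Finset (ZMod (3 * l + 1)) := Finset.univ.filter fun j => l < j.val ∧ j.val ≤ 2 * l
  have hJ : J.card = l := by
    have : J.card = (Finset.Ioc l (2 * l)).card := by
      refine Finset.card_bij (fun j _ => j.val) (fun j hj => by simpa [J] using hj)
        (fun i _ j _ h => ZMod.val_injective _ h) fun b hb => ?_
      rw [Finset.mem_Ioc] at hb
      have hv : ((b : ℕ) : ZMod (3 * l + 1)).val = b := ZMod.val_cast_of_lt (by omega)
      exact ⟨b, by simpa [J, hv] using hb, hv⟩
    rw [this, Nat.card_Ioc]
    omega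
  refine ⟨Finset.univ.filter fun x => φ x ∈ J, fun a ha b hb hab => ?_, ?_⟩
  · simp only [Finset.mem_filter, Finset.mem_univ, true_and, J, map_add] at ha hb hab
    exact ZMod.sum_notMem_middle_third ha hb hab
  · have hfib : ∀ j ∈ J, ((Finset.univ.filter fun x => φ x ∈ J).filter fun x => φ x = j).card =
        Nat.card φ.ker := by
      intro j hj
      obtain ⟨x, rfl⟩ := hφ j
      rw [Finset.filter_filter, Finset.filter_congr (q := fun a => φ a = φ x)
        fun a _ => ⟨And.right, fun h => ⟨h ▸ hj, h⟩⟩, ← card_kerFiber, Nat.card_eq_fintype_card,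
        ← Finset.card_univ]
      congr 1
      ext
      simp [mem_kerFiber]
    have hcard : (Finset.univ.filter fun x => φ x ∈ J).card = l * Nat.card φ.ker := by
      rw [Finset.card_eq_sum_card_fiberwise (f := φ) (t := J) fun x hx => by simpa using hx,
        Finset.sum_congr rfl hfib, Finset.sum_const, hJ, smul_eq_mul]
    rw [hcard, hl, ← card_ker_mul_eq hφ, Nat.add_sub_cancel]
    ring

end Profile

lemma mod_six_eq_one_of_dvd {n d : ℕ}
    (hno : ∀ q : ℕ, q.Prime → q % 3 = 2 → ¬ q ∣ n) (h3 : ¬ 3 ∣ n) (hd : d ∣ n) : d % 6 = 1 := by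
  have h2 : d % 2 = 1 := by
    by_contra h
    exact hno 2 Nat.prime_two rfl ((by omega : 2 ∣ d).trans hd)
  have hmod : ∀ e : ℕ, e ≠ 0 → e ∣ n → e % 3 = 1 := by
    intro e
    induction e using Nat.recOnMul with
    | zero => simp
    | one => simp
    | prime p hp =>
      intro _ hpn
      have := hno p hp
      have : p % 3 ≠ 0 := fun h => h3 ((Nat.dvd_of_mod_eq_zero h).trans hpn)
      have : p % 3 ≠ 2 := fun h => hno p hp h hpn
      omega
    | mul a b iha ihb =>
      intro h0 hab
      rw [Nat.mul_mod, iha (left_ne_zero_of_mul h0) ((Dvd.intro _ rfl).trans hab),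
        ihb (right_ne_zero_of_mul h0) ((Dvd.intro_left _ rfl).trans hab)]
  have := hmod d (by rintro rfl; simp at h2) hd
  omega

/-- Green–Ruzsa, case (c): if `G` is a finite abelian group of order `n > 1`,
no prime `≡ 2 (mod 3)` divides `n`, and `3 ∤ n`, then
`α(G) = n/3 − n/(3m)` where `m` is the exponent of `G`. -/
theorem green_ruzsa_case_c {G : Type*} [CommGroup G] [Fintype G]
    (hn : 1 < Fintype.card G)
    (hno : ∀ q : ℕ, q.Prime → q % 3 = 2 → ¬ q ∣ Fintype.card G)
    (h3 : ¬ 3 ∣ Fintype.card G) :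
    (alphaPF G : ℚ) =
      Fintype.card G / 3 - Fintype.card G / (3 * Monoid.exponent G) := by
  classical
  have hdvd : ∀ d, d ∣ Fintype.card G → d % 6 = 1 := fun d => mod_six_eq_one_of_dvd hno h3
  have hexp : Monoid.exponent G % 6 = 1 := hdvd _ Group.exponent_dvd_card
  obtain ⟨A, hA, hcard⟩ := exists_sumFree_card_eq (G := Additive G)
    (by rw [AddMonoid.exponent_additive]; omega)
  have hadd : Fintype.card (Additive G) = Fintype.card G :=
    Fintype.card_congr Additive.toMul
  rw [AddMonoid.exponent_additive, hadd] at hcard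
  have hmax : IsGreatest {k | ∃ S : Finset G, IsProductFree S ∧ S.card = k} A.card := by
    refine ⟨⟨A, ?_, rfl⟩, ?_⟩
    · rintro a ha b hb _ hc rfl
      exact hA a ha b hb hc
    rintro _ ⟨S, hS, rfl⟩
    have hle := card_mul_le_of_sumFree (G := Additive G) (by rwa [hadd])
      (by rw [hadd]; exact hno 5 (by norm_num) rfl) (A := S) fun a ha b hb hab => hS a ha b hb _ hab rfl
    rw [AddMonoid.exponent_additive, hadd, ← hcard] at hle
    exact Nat.le_of_mul_le_mul_left hle (by omega)
  rw [alphaPF, hmax.csSup_eq]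
  have hm : (Monoid.exponent G : ℚ) ≠ 0 := by
    rw [Nat.cast_ne_zero]
    omega
  have hq : (3 : ℚ) * Monoid.exponent G * A.card =
      Fintype.card G * (Monoid.exponent G - 1) := by
    rw [← Nat.cast_one, ← Nat.cast_sub (by omega : 1 ≤ Monoid.exponent G)]
    exact_mod_cast hcard
  field_simp
  linarith
end
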